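/- arXiv:1702.03787 — 3 statements merged into one kernel-verified Lean document; each statement's English description precedes it below -/
import Mathlib

section
/- Let T, S be simple graphs on vertex set ℕ. (a) If ρ : ℕ → ℕ is a graph isomorphism from T onto S, t ∈ G_S, and ε ∈ {−1, 1}, then the assignment v_i ↦ t v_{ρ(i)}^ε t^{−1} extends to a group isomorphism from G_T onto G_S. (b) Conversely, every group isomorphism θ : G_T → G_S is of this form: there are a graph isomorphism ρ from T onto S, t ∈ G_S, and ε ∈ {−1, 1} such that θ(v_i) = t v_{ρ(i)}^ε t^{−1} for all i ∈ ℕ. In particular, T is isomorphic to S (as graphs) if and only if G_T is isomorphic to G_S (as groups). -/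
/-- The relators of Williams' group `G_T` associated to a graph with adjacency relation
`Adj`: the relators are `v_i^7`, `(v_i v_j)^11` for adjacent `i, j`, and `(v_i v_j)^13`
for distinct non-adjacent `i, j`. -/
def grRels (Adj : ℕ → ℕ → Prop) : Set (FreeGroup ℕ) :=
  {r | (∃ i, r = FreeGroup.of i ^ 7) ∨
    (∃ i j, Adj i j ∧ r = (FreeGroup.of i * FreeGroup.of j) ^ 11) ∨
    (∃ i j, i ≠ j ∧ ¬ Adj i j ∧ r = (FreeGroup.of i * FreeGroup.of j) ^ 13)}

/-- Williams' group `G_T`, presented by the generators `v_i` and the relators above. -/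
abbrev GT (Adj : ℕ → ℕ → Prop) : Type := PresentedGroup (grRels Adj)

/-- The generator `v_i` of `G_T`. -/
def gen (Adj : ℕ → ℕ → Prop) (i : ℕ) : GT Adj := PresentedGroup.of i


namespace GW
open Equiv

/-- alternating letter sequences -/
def Alt (c : ℕ → ℕ) : Prop := (∀ k, c (k + 2) = c k) ∧ c 0 ≠ c 1

/-- the shift of a letter sequence -/
def sh (a : ℕ) (c : ℕ → ℕ) : ℕ → ℕ := fun k => c (k + a)

theorem Alt.ne {c : ℕ → ℕ} (h : Alt c) (k : ℕ) : c k ≠ c (k + 1) := by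
  induction k with
  | zero => exact h.2
  | succ n ih => rw [show n + 1 + 1 = n + 2 by ring, h.1]; exact ih.symm

theorem Alt.sh {c : ℕ → ℕ} (h : Alt c) (a : ℕ) : Alt (sh a c) := by
  refine ⟨fun k => ?_, ?_⟩
  · simp only [GW.sh]; rw [show k + 2 + a = (k + a) + 2 by ring, h.1]
  · simp only [GW.sh]; rw [show 0 + a = a by ring, show 1 + a = a + 1 by ring]; exact h.ne a

theorem Alt.two_mul {c : ℕ → ℕ} (h : Alt c) (k n : ℕ) : c (k + 2 * n) = c k := by
  induction n with
  | zero => rfl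
  | succ n ih => rw [show k + 2 * (n + 1) = (k + 2 * n) + 2 by ring, h.1, ih]

theorem Alt.align {c c' : ℕ → ℕ} (h : Alt c) (h' : Alt c') {k t : ℕ} (h0 : c' k = c t)
    (h1 : c' (k + 1) = c (t + 1)) : GW.sh k c' = GW.sh t c := by
  have : ∀ n, c' (n + k) = c (n + t) ∧ c' (n + 1 + k) = c (n + 1 + t) := by
    intro n
    induction n with
    | zero => 
      refine ⟨by simpa using h0, ?_⟩
      rw [show 0 + 1 + k = k + 1 by ring, show 0 + 1 + t = t + 1 by ring]; exact h1
    | succ n ih =>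
      refine ⟨ih.2, ?_⟩
      rw [show n + 1 + 1 + k = (n + k) + 2 by ring, show n + 1 + 1 + t = (n + t) + 2 by ring,
        h.1, h'.1]
      exact ih.1
  funext n
  exact (this n).1

/-- the orbit of a point along a letter sequence -/
def orb {Ω : Type} (f : ℕ → Perm Ω) (c : ℕ → ℕ) (x : Ω) : ℕ → Ω
  | 0 => x
  | k + 1 => f (c k) (orb f c x k)

/-- a run of length `L` -/
def Run {Ω : Type} (f : ℕ → Perm Ω) (c : ℕ → ℕ) (x : Ω) (L : ℕ) : Prop :=
  ∀ k < L, f (c k) (orb f c x k) ≠ orb f c x k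

/-- closed cells -/
def Closed {Ω : Type} (m : ℕ → ℕ → ℕ) (f : ℕ → Perm Ω) (c : ℕ → ℕ) (x : Ω) : Prop :=
  Run f c x (2 * m (c 0) (c 1)) ∧ orb f c x (2 * m (c 0) (c 1)) = x

section
variable {Ω : Type} {m : ℕ → ℕ → ℕ} {f : ℕ → Perm Ω} {c : ℕ → ℕ} {x : Ω}

theorem orb_add (a b : ℕ) : orb f c x (b + a) = orb f (sh a c) (orb f c x a) b := by
  induction b with
  | zero => simp [orb]
  | succ n ih => rw [show n + 1 + a = (n + a) + 1 by ring]; simp only [orb, sh]; rw [ih]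

theorem Run.mono {L L' : ℕ} (h : Run f c x L) (hl : L' ≤ L) : Run f c x L' :=
  fun k hk => h k (by omega)

theorem Run.shift {a L : ℕ} (h : Run f c x (L + a)) : Run f (sh a c) (orb f c x a) L := by
  intro k hk
  rw [← orb_add]
  exact h (k + a) (by omega)

theorem Run.unshift {L : ℕ} (h0 : f (c 0) x ≠ x) (h : Run f (sh 1 c) (f (c 0) x) L) :
    Run f c x (L + 1) := by
  intro k hk
  cases k with
  | zero => exact h0
  | succ n =>
    rw [orb_add]
    exact h n (by omega)

theorem mm_sh (hm : ∀ i j, m i j = m j i) (hc : Alt c) (a : ℕ) :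
    m (sh a c 0) (sh a c 1) = m (c 0) (c 1) := by
  induction a with
  | zero => rfl
  | succ n ih =>
    rw [← ih]
    simp only [sh]
    rw [show 1 + (n + 1) = n + 2 by ring, hc.1, hm, show 0 + n = n by ring,
      show 0 + (n + 1) = 1 + n by ring]

theorem closed_sh_one (hm : ∀ i j, m i j = m j i) (hc : Alt c) (h1 : 1 ≤ m (c 0) (c 1)) :
    Closed m f (sh 1 c) (orb f c x 1) ↔ Closed m f c x := by
  unfold Closed
  rw [mm_sh hm hc]
  set M := m (c 0) (c 1)
  have hp : c (2 * M) = c 0 := by simpa using hc.two_mul 0 M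
  rw [← orb_add]
  constructor
  · rintro ⟨hr, he⟩
    have he' : orb f c x (2 * M) = x := by
      have h2 : f (c (2 * M)) (orb f c x (2 * M)) = f (c 0) x := he
      rw [hp] at h2
      exact (f (c 0)).injective h2
    refine ⟨?_, he'⟩
    have hx : f (c 0) x ≠ x := by
      have := hr (2 * M - 1) (by omega)
      rw [← orb_add] at this
      simp only [sh] at this
      rw [show 2 * M - 1 + 1 = 2 * M by omega, he', hp] at this
      exact this
    exact (Run.unshift hx hr).mono (by omega)
  · rintro ⟨hr, he⟩
    refine ⟨?_, ?_⟩
    · apply Run.shift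
      intro k hk
      by_cases hk' : k < 2 * M
      · exact hr k hk'
      · have : k = 2 * M := by omega
        subst this
        rw [he, hp]
        exact hr 0 (by omega)
    · change f (c (2 * M)) (orb f c x (2 * M)) = f (c 0) x
      rw [hp, he]

theorem closed_sh (hm : ∀ i j, m i j = m j i) (hc : Alt c) (h1 : 1 ≤ m (c 0) (c 1)) (a : ℕ) :
    Closed m f (sh a c) (orb f c x a) ↔ Closed m f c x := by
  induction a with
  | zero => rfl
  | succ n ih =>
    rw [← ih]
    have := closed_sh_one (f := f) (x := orb f c x n) hm (hc.sh n) (by rw [mm_sh hm hc]; exact h1)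
    rw [← this]
    rw [← orb_add, show 1 + n = n + 1 by ring]
    have : sh 1 (sh n c) = sh (n + 1) c := by
      funext k; simp only [sh]; congr 1; ring
    rw [this]

end

open Classical in
theorem glue {Ω K : Type} (f : ℕ → Perm Ω) (hf : ∀ i, f i ^ 7 = 1) (ℓ : K → ℕ)
    (g : K → ZMod 7 → Ω)
    (hinj : ∀ κ κ' s s', ℓ κ = ℓ κ' → g κ s = g κ' s' → κ = κ' ∧ s = s')
    (hin : ∀ κ s, f (ℓ κ) (g κ s) = g κ s) :
    ∃ f' : ℕ → Perm Ω, (∀ i, f' i ^ 7 = 1) ∧ (∀ κ s, f' (ℓ κ) (g κ s) = g κ (s + 1)) ∧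
      (∀ i x, (∀ κ s, ℓ κ = i → g κ s ≠ x) → f' i x = f i x) := by
  let F : ℕ → ZMod 7 → Ω → Ω := fun i r x =>
    if h : ∃ q : K × ZMod 7, ℓ q.1 = i ∧ g q.1 q.2 = x then
      g h.choose.1 (h.choose.2 + r) else x
  have F1 : ∀ κ s r, F (ℓ κ) r (g κ s) = g κ (s + r) := by
    intro κ s r
    have h : ∃ q : K × ZMod 7, ℓ q.1 = ℓ κ ∧ g q.1 q.2 = g κ s := ⟨(κ, s), rfl, rfl⟩
    simp only [F]
    rw [dif_pos h]
    obtain ⟨h1, h2⟩ := hinj _ _ _ _ h.choose_spec.1 h.choose_spec.2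
    rw [h1, h2]
  have F2 : ∀ i r x, (∀ κ s, ℓ κ = i → g κ s ≠ x) → F i r x = x := by
    intro i r x h
    simp only [F]
    rw [dif_neg]
    rintro ⟨q, h1, h2⟩
    exact h _ _ h1 h2
  have Fadd : ∀ i r r' x, F i r (F i r' x) = F i (r' + r) x := by
    intro i r r' x
    by_cases h : ∀ κ s, ℓ κ = i → g κ s ≠ x
    · rw [F2 i r' x h, F2 i r x h, F2 i _ x h]
    · push Not at h
      obtain ⟨κ, s, rfl, rfl⟩ := h
      rw [F1, F1, F1, add_assoc]
  have F0 : ∀ i x, F i 0 x = x := by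
    intro i x
    by_cases h : ∀ κ s, ℓ κ = i → g κ s ≠ x
    · rw [F2 i _ x h]
    · push Not at h
      obtain ⟨κ, s, rfl, rfl⟩ := h
      rw [F1, add_zero]
  let h : ℕ → Perm Ω := fun i =>
    { toFun := F i 1
      invFun := F i (-1)
      left_inv := fun x => by rw [Fadd]; simp [F0]
      right_inv := fun x => by rw [Fadd]; simp [F0] }
  have hpow : ∀ i (n : ℕ) x, (h i ^ n) x = F i n x := by
    intro i n x
    induction n with
    | zero => simp [F0]
    | succ n ih =>
      rw [pow_succ', Perm.mul_apply, ih]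
      change F i 1 (F i n x) = _
      rw [Fadd]; push_cast; rfl
  have h7 : ∀ i, h i ^ 7 = 1 := by
    intro i
    ext x
    rw [hpow]
    have : ((7 : ℕ) : ZMod 7) = 0 := by decide
    rw [this, F0]; rfl
  have hcomm : ∀ i, Commute (f i) (h i) := by
    intro i
    ext x
    change f i (F i 1 x) = F i 1 (f i x)
    by_cases hx : ∀ κ s, ℓ κ = i → g κ s ≠ x
    · rw [F2 i 1 x hx, F2]
      intro κ s hk hg
      have := hin κ s
      rw [hk, hg] at this
      exact hx κ s hk (hg.trans ((f i).injective this))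
    · push Not at hx
      obtain ⟨κ, s, rfl, rfl⟩ := hx
      rw [F1, hin, hin, F1]
  refine ⟨fun i => f i * h i, fun i => ?_, fun κ s => ?_, fun i x hx => ?_⟩
  · rw [(hcomm i).mul_pow, hf, h7, one_mul]
  · change f (ℓ κ) (F (ℓ κ) 1 (g κ s)) = _
    rw [F1, hin]
  · change f i (F i 1 x) = _
    rw [F2 i 1 x hx]

theorem stageA {Ω : Type} (f : ℕ → Perm Ω) (hf : ∀ i, f i ^ 7 = 1) :
    ∃ (Ω' : Type) (f' : ℕ → Perm Ω') (ι : Ω → Ω'), Function.Injective ι ∧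
      (∀ i, f' i ^ 7 = 1) ∧
      (∀ i x, f i x ≠ x → f' i (ι x) = ι (f i x)) ∧
      (∀ i x, f' i (ι x) ≠ ι x) ∧
      (∀ i x y, f' i (ι x) = ι y → f i x = y) ∧
      (∀ z ∉ Set.range ι, ∀ i j, f' i z ≠ z → f' j z ≠ z → i = j) ∧
      (∀ i x z, f' i (ι x) = z → f' i z ∈ Set.range ι → z ∈ Set.range ι) := by
  classical
  let K := {q : Ω × ℕ // f q.2 q.1 = q.1}
  let g : K → ZMod 7 → Ω ⊕ (Ω × ℕ × ZMod 7) := fun κ s =>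
    if s = 0 then Sum.inl κ.1.1 else Sum.inr (κ.1.1, κ.1.2, s)
  let f0 : ℕ → Perm (Ω ⊕ (Ω × ℕ × ZMod 7)) := fun i => Perm.sumCongr (f i) 1
  have f0l : ∀ i x, f0 i (Sum.inl x) = Sum.inl (f i x) := fun i x => rfl
  have f0r : ∀ i x, f0 i (Sum.inr x) = Sum.inr x := fun i x => rfl
  have f07 : ∀ i, f0 i ^ 7 = 1 := by
    intro i
    have : ∀ n : ℕ, f0 i ^ n = Perm.sumCongr (f i ^ n) 1 := by
      intro n
      induction n with
      | zero => simp
      | succ n ih => rw [pow_succ, ih, Perm.sumCongr_mul, pow_succ]; simp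
    rw [this, hf]; simp
  obtain ⟨f', h7, hg, hn⟩ := glue f0 f07 (fun κ : K => κ.1.2) g (by
    rintro ⟨⟨x, i⟩, hx⟩ ⟨⟨x', i'⟩, hx'⟩ s s' h1 h2
    simp only at h1
    subst h1
    simp only [g] at h2
    split_ifs at h2 with h3 h4 h4
    · simp at h2; subst h2; simp [h3, h4]
    · simp at h2; obtain ⟨rfl, rfl⟩ := h2; simp) (by
    rintro ⟨⟨x, i⟩, hx⟩ s
    simp only [g]
    split_ifs
    · rw [f0l]; simp only at hx; rw [hx]
    · rw [f0r])
  have A1 : ∀ i x, f i x ≠ x → f' i (Sum.inl x) = Sum.inl (f i x) := by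
    intro i x hx
    rw [hn, f0l]
    rintro ⟨⟨x', i'⟩, hx'⟩ s h1 h2
    simp only at h1 hx'
    subst h1
    simp only [g] at h2
    split_ifs at h2
    simp at h2
    subst h2
    exact hx hx'
  have A2 : ∀ i x, f i x = x → f' i (Sum.inl x) = Sum.inr (x, i, 1) := by
    intro i x hx
    have := hg ⟨(x, i), hx⟩ 0
    have h10 : (1 : ZMod 7) ≠ 0 := by decide
    simpa [g, h10] using this
  have A3 : ∀ i x j s, f' i (Sum.inr (x, j, s)) ≠ Sum.inr (x, j, s) → i = j ∧ f j x = x ∧ s ≠ 0 := by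
    intro i x j s h
    by_contra hcon
    apply h
    rw [hn, f0r]
    rintro ⟨⟨x', i'⟩, hx'⟩ s' h1 h2
    simp only at h1 hx'
    subst h1
    simp only [g] at h2
    split_ifs at h2 with h3
    simp at h2
    obtain ⟨rfl, rfl, rfl⟩ := h2
    exact hcon ⟨rfl, hx', h3⟩
  refine ⟨_, f', Sum.inl, Sum.inl_injective, h7, A1, ?_, ?_, ?_, ?_⟩
  · intro i x
    by_cases hx : f i x = x
    · rw [A2 i x hx]; simp
    · rw [A1 i x hx]; simpa using hx
  · intro i x y h
    by_cases hx : f i x = x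
    · rw [A2 i x hx] at h; simp at h
    · rw [A1 i x hx] at h; simpa using h
  · rintro (z | ⟨x, k, s⟩) hz i j hi hj
    · simp at hz
    · rw [(A3 _ _ _ _ hi).1, (A3 _ _ _ _ hj).1]
  · intro i x z h1 h2
    by_cases hx : f i x = x
    · rw [A2 i x hx] at h1
      subst h1
      have := hg ⟨(x, i), hx⟩ 1
      rw [show g ⟨(x, i), hx⟩ 1 = Sum.inr (x, i, 1) by
          simp only [g]; rw [if_neg (by decide)],
        show g ⟨(x, i), hx⟩ (1 + 1) = Sum.inr (x, i, 2) by
          simp only [g]; rw [if_neg (by decide)]; rfl] at this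
      simp only at this
      rw [this] at h2
      simp at h2
    · rw [A1 i x hx] at h1
      exact ⟨_, h1⟩

end GW

namespace GW
open Equiv

/-- the small-cancellation invariant -/
def Inv {Ω : Type} (m : ℕ → ℕ → ℕ) (f : ℕ → Perm Ω) : Prop :=
  ∀ c x, Alt c → Run f c x (2 * m (c 0) (c 1) - 2) → Closed m f c x

theorem transport {Ω Ω' : Type} {f : ℕ → Perm Ω} {f' : ℕ → Perm Ω'} {ι : Ω → Ω'}
    (h : ∀ i x, f i x ≠ x → f' i (ι x) = ι (f i x)) {c : ℕ → ℕ} {x : Ω} {L : ℕ}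
    (hr : Run f c x L) : ∀ k ≤ L, orb f' c (ι x) k = ι (orb f c x k) := by
  intro k
  induction k with
  | zero => intro _; rfl
  | succ n ih =>
    intro hn
    simp only [orb]
    rw [ih (by omega), h _ _ (hr n (by omega))]

theorem transport_run {Ω Ω' : Type} {f : ℕ → Perm Ω} {f' : ℕ → Perm Ω'} {ι : Ω → Ω'}
    (hi : Function.Injective ι)
    (h : ∀ i x, f i x ≠ x → f' i (ι x) = ι (f i x)) {c : ℕ → ℕ} {x : Ω} {L : ℕ}
    (hr : Run f c x L) : Run f' c (ι x) L := by
  intro k hk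
  rw [transport h hr k hk.le, h _ _ (hr k hk)]
  exact fun h' => hr k hk (hi h')

theorem transport_closed {Ω Ω' : Type} {f : ℕ → Perm Ω} {f' : ℕ → Perm Ω'} {ι : Ω → Ω'}
    (hi : Function.Injective ι) {m : ℕ → ℕ → ℕ}
    (h : ∀ i x, f i x ≠ x → f' i (ι x) = ι (f i x)) {c : ℕ → ℕ} {x : Ω}
    (hr : Closed m f c x) : Closed m f' c (ι x) := by
  refine ⟨transport_run hi h hr.1, ?_⟩
  rw [transport h hr.1 _ le_rfl, hr.2]

/-- properties of the structure after stage A -/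
structure PA {Ω : Type} (m : ℕ → ℕ → ℕ) (f : ℕ → Perm Ω) (O : Set Ω) : Prop where
  sym : ∀ i j, m i j = m j i
  hM : ∀ i j, i ≠ j → 3 ≤ m i j
  P1 : ∀ z ∉ O, ∀ i j, f i z ≠ z → f j z ≠ z → i = j
  P4 : ∀ z ∈ O, ∀ i, f i z ≠ z
  P5 : ∀ i w z, w ∈ O → f i w = z → f i z ∈ O → z ∈ O
  P3 : ∀ c x, Alt c → Run f c x (2 * m (c 0) (c 1)) → Closed m f c x

theorem interior {Ω : Type} {f : ℕ → Perm Ω} {O : Set Ω}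
    (h1 : ∀ z ∉ O, ∀ i j, f i z ≠ z → f j z ≠ z → i = j) {c : ℕ → ℕ} (hc : Alt c) {x : Ω}
    {L k : ℕ} (hr : Run f c x L) (h0 : 0 < k) (hk : k < L) : orb f c x k ∈ O := by
  by_contra hcon
  obtain ⟨k, rfl⟩ : ∃ k', k = k' + 1 := ⟨k - 1, by omega⟩
  refine hc.ne k (h1 _ hcon _ _ ?_ (hr (k + 1) hk))
  have := hr k (by omega)
  intro h2
  exact this ((f (c k)).injective h2)

theorem postA {Ω : Type} {m : ℕ → ℕ → ℕ} (hs : ∀ i j, m i j = m j i)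
    (hM : ∀ i j, i ≠ j → 3 ≤ m i j) {f : ℕ → Perm Ω} (hf : ∀ i, f i ^ 7 = 1) (hI : Inv m f) :
    ∃ (Ω' : Type) (f' : ℕ → Perm Ω') (ι : Ω → Ω'), Function.Injective ι ∧
      (∀ i, f' i ^ 7 = 1) ∧
      (∀ i x, f i x ≠ x → f' i (ι x) = ι (f i x)) ∧
      PA m f' (Set.range ι) := by
  obtain ⟨Ω', f', ι, h1, h2, h3, h4, h5, h6, h7⟩ := stageA f hf
  refine ⟨Ω', f', ι, h1, h2, h3, hs, hM, h6, ?_, ?_, ?_⟩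
  · rintro _ ⟨x, rfl⟩ i
    exact h4 i x
  · rintro i _ z ⟨x, rfl⟩ hz hz'
    exact h7 i x z hz hz'
  · intro c x hc hr
    have hM' := hM _ _ hc.2
    set M := m (c 0) (c 1) with hMd
    have hO : ∀ k, 0 < k → k < 2 * M → orb f' c x k ∈ Set.range ι :=
      fun k a b => interior h6 hc hr a b
    obtain ⟨y, hy⟩ := hO 1 (by omega) (by omega)
    have key : ∀ k, k ≤ 2 * M - 2 → orb f' c x (k + 1) = ι (orb f (sh 1 c) y k) ∧
        Run f (sh 1 c) y k := by
      intro k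
      induction k with
      | zero => intro _; exact ⟨hy.symm, fun k hk => by omega⟩
      | succ n ih =>
        intro hn
        obtain ⟨i1, i2⟩ := ih (by omega)
        obtain ⟨z, hz⟩ := hO (n + 1 + 1) (by omega) (by omega)
        have e1 : f' (c (n + 1)) (ι (orb f (sh 1 c) y n)) = ι z := by
          rw [← i1, hz]; rfl
        have e2 := h5 _ _ _ e1
        have e3 : orb f (sh 1 c) y (n + 1) = z := e2
        refine ⟨by rw [e3, hz], ?_⟩
        intro k hk
        by_cases hk' : k < n
        · exact i2 k hk'
        · have : k = n := by omega
          subst this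
          change f (c (k + 1)) _ ≠ _
          rw [e2]
          intro e4
          have := hr (k + 1) (by omega)
          apply this
          rw [i1, e1, e4]
    have hcl := hI (sh 1 c) y (hc.sh 1) (by rw [mm_sh hs hc]; exact (key _ le_rfl).2)
    have := transport_closed h1 h3 hcl
    rw [hy] at this
    exact (closed_sh_one hs hc (by omega)).1 this

section stageC
variable {Ω : Type}

/-- the cells to be filled in -/
@[ext] structure Cell (m : ℕ → ℕ → ℕ) (f : ℕ → Perm Ω) (O : Set Ω) where
  c : ℕ → ℕ
  x : Ω
  L : ℕ
  alt : Alt c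
  hx : x ∉ O
  hL1 : 2 * m (c 0) (c 1) - 2 ≤ L
  hL2 : L + 1 ≤ 2 * m (c 0) (c 1)
  run : Run f c x L
  hy : orb f c x L ∉ O

variable {m : ℕ → ℕ → ℕ} {f : ℕ → Perm Ω} {O : Set Ω}

/-- the half-length of a cell -/
def Cell.M (κ : Cell m f O) : ℕ := m (κ.c 0) (κ.c 1)

/-- boundary points of a cell -/
def Cell.P (κ : Cell m f O) (t : ℕ) : Ω ⊕ (Cell m f O × ℕ × ZMod 7) :=
  if t ≤ κ.L then Sum.inl (orb f κ.c κ.x t)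
  else if t < 2 * κ.M then Sum.inr (κ, t, 0) else Sum.inl κ.x

/-- the new cycles of a cell -/
def Cell.g (κ : Cell m f O) (t : ℕ) (s : ZMod 7) : Ω ⊕ (Cell m f O × ℕ × ZMod 7) :=
  if s = 0 then κ.P t else if s = 1 then κ.P (t + 1) else Sum.inr (κ, t, s)

theorem Cell.g_cases (κ : Cell m f O) (t : ℕ) (s : ZMod 7) (h1 : κ.L ≤ t) (h2 : t < 2 * κ.M) :
    (s = 0 ∧ t = κ.L ∧ κ.g t s = Sum.inl (orb f κ.c κ.x κ.L)) ∨
    (s = 1 ∧ t + 1 = 2 * κ.M ∧ κ.g t s = Sum.inl κ.x) ∨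
    (s = 0 ∧ κ.L < t ∧ κ.g t s = Sum.inr (κ, t, 0)) ∨
    (s = 1 ∧ t + 1 < 2 * κ.M ∧ κ.g t s = Sum.inr (κ, t + 1, 0)) ∨
    (s ≠ 0 ∧ s ≠ 1 ∧ κ.g t s = Sum.inr (κ, t, s)) := by
  have h10 : (1 : ZMod 7) ≠ 0 := by decide
  by_cases hs0 : s = 0
  · subst hs0
    by_cases ht : t = κ.L
    · subst ht; left; simp [Cell.g, Cell.P]
    · right; right; left
      refine ⟨rfl, by omega, ?_⟩
      simp only [Cell.g, Cell.P, if_true]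
      rw [if_neg (by omega), if_pos h2]
  · by_cases hs1 : s = 1
    · subst hs1
      by_cases ht : t + 1 = 2 * κ.M
      · right; left
        refine ⟨rfl, ht, ?_⟩
        simp only [Cell.g, Cell.P, if_true]
        rw [if_neg h10, if_neg (by omega), if_neg (by omega)]
      · right; right; right; left
        refine ⟨rfl, by omega, ?_⟩
        simp only [Cell.g, Cell.P, if_true]
        rw [if_neg h10, if_neg (by omega), if_pos (by omega)]
    · right; right; right; right
      refine ⟨hs0, hs1, ?_⟩
      simp only [Cell.g]
      rw [if_neg hs0, if_neg hs1]

theorem Cell.L_ge (hA : PA m f O) (κ : Cell m f O) : 4 ≤ κ.L := by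
  have := hA.hM _ _ κ.alt.2
  have := κ.hL1
  omega

theorem Cell.L_lt (κ : Cell m f O) : κ.L < 2 * κ.M := by
  have := κ.hL2
  unfold Cell.M
  omega

theorem Cell.x_act (hA : PA m f O) (κ : Cell m f O) (i : ℕ) (h : f i κ.x ≠ κ.x) : i = κ.c 0 :=
  hA.P1 _ κ.hx _ _ h (κ.run 0 (by have := κ.L_ge hA; omega))

theorem Cell.y_act' (hA : PA m f O) (κ : Cell m f O) :
    f (κ.c (κ.L - 1)) (orb f κ.c κ.x κ.L) ≠ orb f κ.c κ.x κ.L ∧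
      orb f κ.c κ.x κ.L = f (κ.c (κ.L - 1)) (orb f κ.c κ.x (κ.L - 1)) := by
  have h4 := κ.L_ge hA
  have e : orb f κ.c κ.x κ.L = f (κ.c (κ.L - 1)) (orb f κ.c κ.x (κ.L - 1)) := by
    conv_lhs => rw [show κ.L = κ.L - 1 + 1 by omega]
    rfl
  refine ⟨?_, e⟩
  have := κ.run (κ.L - 1) (by omega)
  rw [e]
  intro h
  exact this ((f _).injective h)

theorem Cell.y_act (hA : PA m f O) (κ : Cell m f O) (i : ℕ)
    (h : f i (orb f κ.c κ.x κ.L) ≠ orb f κ.c κ.x κ.L) : i = κ.c (κ.L - 1) :=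
  hA.P1 _ κ.hy _ _ h (κ.y_act' hA).1

theorem Cell.x_ne_y (hA : PA m f O) (κ κ' : Cell m f O) : κ.x ≠ orb f κ'.c κ'.x κ'.L := by
  intro h
  have h4 := κ.L_ge hA
  have h4' := κ'.L_ge hA
  have h1 : f (κ.c 0) κ.x ∈ O := interior hA.P1 κ.alt κ.run (k := 1) (by omega) (by omega)
  have h2 : orb f κ'.c κ'.x (κ'.L - 1) ∈ O :=
    interior hA.P1 κ'.alt κ'.run (by omega) (by omega)
  have h3 := κ.x_act hA (κ'.c (κ'.L - 1)) (by rw [h]; exact (κ'.y_act' hA).1)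
  refine κ.hx (hA.P5 _ _ _ h2 ((κ'.y_act' hA).2.symm.trans h.symm) ?_)
  rw [h3]; exact h1

theorem Cell.xx (hA : PA m f O) (κ κ' : Cell m f O) (h : κ.x = κ'.x) (h1 : κ.c 1 = κ'.c 1) :
    κ = κ' := by
  have h4 := κ.L_ge hA
  have h4' := κ'.L_ge hA
  have h0 : κ.c 0 = κ'.c 0 := κ'.x_act hA _ (by rw [← h]; exact κ.run 0 (by omega))
  have hc : κ.c = κ'.c := κ'.alt.align κ.alt (k := 0) (t := 0) h0 h1
  have hL : κ.L = κ'.L := by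
    rcases lt_trichotomy κ.L κ'.L with hl | hl | hl
    · exfalso
      apply κ.hy
      rw [hc, h]
      exact interior hA.P1 κ'.alt κ'.run (by omega) (by omega)
    · exact hl
    · exfalso
      apply κ'.hy
      rw [← hc, ← h]
      exact interior hA.P1 κ.alt κ.run (by omega) (by omega)
  exact Cell.ext hc h hL

theorem Cell.yy_aux (hA : PA m f O) (κ κ' : Cell m f O)
    (h : orb f κ.c κ.x κ.L = orb f κ'.c κ'.x κ'.L)
    (h1 : κ.c κ.L = κ'.c κ'.L) (hl : κ.L ≤ κ'.L) : κ = κ' := by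
  have h4 := κ.L_ge hA
  have h4' := κ'.L_ge hA
  have h0 : κ.c (κ.L - 1) = κ'.c (κ'.L - 1) :=
    κ'.y_act hA _ (by rw [← h]; exact (κ.y_act' hA).1)
  have back : ∀ k, k + 1 ≤ κ.L → orb f κ.c κ.x (κ.L - k) = orb f κ'.c κ'.x (κ'.L - k) ∧
      κ.c (κ.L - k) = κ'.c (κ'.L - k) ∧ κ.c (κ.L - k - 1) = κ'.c (κ'.L - k - 1) := by
    intro k
    induction k with
    | zero => intro _; exact ⟨h, h1, h0⟩
    | succ n ih =>
      intro hn
      obtain ⟨i1, i2, i3⟩ := ih (by omega)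
      refine ⟨?_, i3, ?_⟩
      · rw [show κ.L - n = κ.L - (n + 1) + 1 by omega,
          show κ'.L - n = κ'.L - (n + 1) + 1 by omega] at i1
        have i1' : f (κ.c (κ.L - n - 1)) (orb f κ.c κ.x (κ.L - (n + 1))) =
          f (κ'.c (κ'.L - n - 1)) (orb f κ'.c κ'.x (κ'.L - (n + 1))) := i1
        rw [i3] at i1'
        exact (f _).injective i1'
      · have e1 := κ.alt.1 (κ.L - (n + 1) - 1)
        have e2 := κ'.alt.1 (κ'.L - (n + 1) - 1)
        rw [show κ.L - (n + 1) - 1 + 2 = κ.L - n by omega] at e1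
        rw [show κ'.L - (n + 1) - 1 + 2 = κ'.L - n by omega] at e2
        rw [← e1, ← e2, i2]
  obtain ⟨i1, i2, i3⟩ := back (κ.L - 1) (by omega)
  rw [show κ.L - (κ.L - 1) = 1 by omega] at i1 i2 i3
  have hx : κ.x = orb f κ'.c κ'.x (κ'.L - κ.L) := by
    rw [show κ'.L - (κ.L - 1) = κ'.L - κ.L + 1 by omega] at i1 i3
    have i1' : f (κ.c 0) κ.x = f (κ'.c (κ'.L - κ.L)) (orb f κ'.c κ'.x (κ'.L - κ.L)) := i1
    have i3' : κ.c 0 = κ'.c (κ'.L - κ.L) := i3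
    rw [i3'] at i1'
    exact (f _).injective i1'
  rcases hl.lt_or_eq with hl | hl
  · exfalso
    apply κ.hx
    rw [hx]
    exact interior hA.P1 κ'.alt κ'.run (by omega) (by omega)
  · rw [← hl] at hx i2
    refine κ.xx hA κ' (by simpa [orb] using hx) ?_
    rw [i2]; congr 1; omega

theorem Cell.yy (hA : PA m f O) (κ κ' : Cell m f O)
    (h : orb f κ.c κ.x κ.L = orb f κ'.c κ'.x κ'.L)
    (h1 : κ.c κ.L = κ'.c κ'.L) : κ = κ' := by
  rcases le_total κ.L κ'.L with hl | hl
  · exact κ.yy_aux hA κ' h h1 hl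
  · exact (κ'.yy_aux hA κ h.symm h1.symm hl).symm

theorem Cell.c_last (κ : Cell m f O) {t : ℕ} (h : t + 1 = 2 * κ.M) : κ.c t = κ.c 1 := by
  have h1 := κ.alt.1 t
  have h2 := κ.alt.two_mul 1 κ.M
  rw [← h2, ← h, ← h1]; congr 1; ring

theorem Cell.c_2M (κ : Cell m f O) {t : ℕ} (h : t = 2 * κ.M) : κ.c t = κ.c 0 := by
  have h2 := κ.alt.two_mul 0 κ.M
  rw [h, ← h2, zero_add]

theorem Cell.g_inj (hA : PA m f O) (κ κ' : Cell m f O) (t t' : ℕ) (s s' : ZMod 7)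
    (h1 : κ.L ≤ t) (h2 : t < 2 * κ.M) (h1' : κ'.L ≤ t') (h2' : t' < 2 * κ'.M)
    (hl : κ.c t = κ'.c t') (h : κ.g t s = κ'.g t' s') : κ = κ' ∧ t = t' ∧ s = s' := by
  rcases κ.g_cases t s h1 h2 with ⟨a, b, e⟩ | ⟨a, b, e⟩ | ⟨a, b, e⟩ | ⟨a, b, e⟩ | ⟨a, b, e⟩ <;>
  rcases κ'.g_cases t' s' h1' h2' with ⟨a', b', e'⟩ | ⟨a', b', e'⟩ | ⟨a', b', e'⟩ |
    ⟨a', b', e'⟩ | ⟨a', b', e'⟩ <;>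
  rw [e, e'] at h <;> simp only [Sum.inl.injEq, Sum.inr.injEq, Prod.mk.injEq, reduceCtorEq] at h
  · have := κ.yy hA κ' h (by rw [← b, ← b', hl])
    subst this
    exact ⟨rfl, by omega, a.trans a'.symm⟩
  · exact absurd h.symm (κ'.x_ne_y hA κ)
  · exact absurd h (κ.x_ne_y hA κ')
  · have := κ.xx hA κ' h (by rw [← κ.c_last b, ← κ'.c_last b', hl])
    subst this
    exact ⟨rfl, by omega, a.trans a'.symm⟩
  · exact ⟨h.1, h.2.1, a.trans a'.symm⟩
  · obtain ⟨rfl, rfl, _⟩ := h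
    exact absurd hl.symm (κ.alt.ne t')
  · exact absurd h.2.2.symm a'
  · obtain ⟨rfl, rfl, _⟩ := h
    exact absurd hl (κ.alt.ne t)
  · exact ⟨h.1, by omega, a.trans a'.symm⟩
  · exact absurd h.2.2.symm a'
  · exact absurd h.2.2 a
  · exact absurd h.2.2 a
  · exact h

end stageC
end GW

namespace GW
open Equiv

section stageC
variable {Ω : Type} {m : ℕ → ℕ → ℕ} {f : ℕ → Perm Ω} {O : Set Ω}

/-- properties of the glued structure -/
structure GC (m : ℕ → ℕ → ℕ) (f : ℕ → Perm Ω) (O : Set Ω)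
    (F : ℕ → Perm (Ω ⊕ (Cell m f O × ℕ × ZMod 7))) : Prop where
  pa : PA m f O
  old : ∀ i x, f i x ≠ x → F i (Sum.inl x) = Sum.inl (f i x)
  step : ∀ (κ : Cell m f O) t s, κ.L ≤ t → t < 2 * κ.M → F (κ.c t) (κ.g t s) = κ.g t (s + 1)
  cases : ∀ d z, F d z ≠ z →
    (∃ z0, z = Sum.inl z0 ∧ f d z0 ≠ z0) ∨
    (∃ (κ : Cell m f O) (t : ℕ) (s : ZMod 7), κ.L ≤ t ∧ t < 2 * κ.M ∧ d = κ.c t ∧ z = κ.g t s)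

theorem exists_GC (hA : PA m f O) (hf : ∀ i, f i ^ 7 = 1) :
    ∃ F : ℕ → Perm (Ω ⊕ (Cell m f O × ℕ × ZMod 7)), (∀ i, F i ^ 7 = 1) ∧ GC m f O F := by
  classical
  let K := {q : Cell m f O × ℕ // q.1.L ≤ q.2 ∧ q.2 < 2 * q.1.M}
  let f0 : ℕ → Perm (Ω ⊕ (Cell m f O × ℕ × ZMod 7)) := fun i => Perm.sumCongr (f i) 1
  have f0l : ∀ i x, f0 i (Sum.inl x) = Sum.inl (f i x) := fun i x => rfl
  have f0r : ∀ i x, f0 i (Sum.inr x) = Sum.inr x := fun i x => rfl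
  have f07 : ∀ i, f0 i ^ 7 = 1 := by
    intro i
    have : ∀ n : ℕ, f0 i ^ n = Perm.sumCongr (f i ^ n) 1 := by
      intro n
      induction n with
      | zero => simp
      | succ n ih => rw [pow_succ, ih, Perm.sumCongr_mul, pow_succ]; simp
    rw [this, hf]; simp
  have hin : ∀ (κ : K) s, f0 (κ.1.1.c κ.1.2) (κ.1.1.g κ.1.2 s) = κ.1.1.g κ.1.2 s := by
    rintro ⟨⟨κ, t⟩, h1, h2⟩ s
    simp only at h1 h2 ⊢
    have h4 := κ.L_ge hA
    rcases κ.g_cases t s h1 h2 with ⟨a, b, e⟩ | ⟨a, b, e⟩ | ⟨a, b, e⟩ | ⟨a, b, e⟩ | ⟨a, b, e⟩ <;>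
    rw [e]
    · rw [f0l, b]
      congr 1
      by_contra hcon
      have h5 := κ.y_act hA _ hcon
      have := κ.alt.ne (κ.L - 1)
      rw [show κ.L - 1 + 1 = κ.L by omega] at this
      exact this h5.symm
    · rw [f0l]
      congr 1
      by_contra hcon
      have h5 := κ.x_act hA _ hcon
      rw [κ.c_last b] at h5
      exact κ.alt.2 h5.symm
    · rfl
    · rfl
    · rfl
  obtain ⟨F, h7, hg, hn⟩ := glue f0 f07 (fun κ : K => κ.1.1.c κ.1.2) (fun κ => κ.1.1.g κ.1.2) (by
    rintro ⟨⟨κ, t⟩, h1, h2⟩ ⟨⟨κ', t'⟩, h1', h2'⟩ s s' hl h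
    obtain ⟨rfl, rfl, rfl⟩ := κ.g_inj hA κ' t t' s s' h1 h2 h1' h2' hl h
    exact ⟨rfl, rfl⟩) hin
  refine ⟨F, h7, hA, ?_, ?_, ?_⟩
  · intro i x hx
    rw [hn, f0l]
    rintro κ s hl he
    have := hin κ s
    rw [he, hl, f0l] at this
    exact hx (Sum.inl_injective this)
  · intro κ t s h1 h2
    exact hg ⟨(κ, t), h1, h2⟩ s
  · intro d z hz
    by_cases hgl : ∀ (κ : K) s, κ.1.1.c κ.1.2 = d → κ.1.1.g κ.1.2 s ≠ z
    · left
      rw [hn d z hgl] at hz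
      rcases z with z | z
      · rw [f0l] at hz
        exact ⟨z, rfl, fun h => hz (by rw [h])⟩
      · exact absurd (f0r _ _) hz
    · right
      push Not at hgl
      obtain ⟨⟨⟨κ, t⟩, h1, h2⟩, s, hd, he⟩ := hgl
      exact ⟨κ, t, s, h1, h2, hd.symm, he.symm⟩

variable {F : ℕ → Perm (Ω ⊕ (Cell m f O × ℕ × ZMod 7))}

theorem GC.orb_cell (h : GC m f O F) (κ : Cell m f O) : ∀ t ≤ 2 * κ.M,
    orb F κ.c (Sum.inl κ.x) t = κ.P t := by
  intro t
  induction t with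
  | zero => intro _; simp [Cell.P, orb]
  | succ n ih =>
    intro hn
    simp only [orb]
    rw [ih (by omega)]
    by_cases hl : n < κ.L
    · simp only [Cell.P]
      rw [if_pos hl.le, if_pos (by omega), h.old _ _ (κ.run n hl)]
      rfl
    · have := h.step κ n 0 (by omega) (by omega)
      have h10 : (1 : ZMod 7) ≠ 0 := by decide
      simpa [Cell.g, h10] using this

theorem GC.cell_closed (h : GC m f O F) (κ : Cell m f O) : Closed m F κ.c (Sum.inl κ.x) := by
  have hL := κ.L_lt
  refine ⟨?_, ?_⟩
  · intro t ht
    by_cases hl : t < κ.L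
    · exact transport_run Sum.inl_injective h.old κ.run t hl
    · change t < 2 * κ.M at ht
      have h2 := h.orb_cell κ (t + 1) (by omega)
      simp only [orb] at h2
      rw [h2, h.orb_cell κ t (by omega)]
      intro h3
      have h10 : (1 : ZMod 7) ≠ 0 := by decide
      have := κ.g_inj h.pa κ t t 1 0 (by omega) (by omega) (by omega) (by omega) rfl
        (by simpa [Cell.g, h10] using h3)
      exact h10 this.2.2
  · have := h.orb_cell κ (2 * κ.M) le_rfl
    change orb F κ.c (Sum.inl κ.x) (2 * κ.M) = _
    rw [this]
    simp only [Cell.P]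
    rw [if_neg (by omega), if_neg (by omega)]

theorem GC.aligned (h : GC m f O F) {c : ℕ → ℕ} (hc : Alt c) {p} (κ : Cell m f O) {k t : ℕ}
    (ht : t ≤ 2 * κ.M) (hp : orb F c p k = κ.P t) (h0 : c k = κ.c t) (h1 : c (k + 1) = κ.c (t + 1)) :
    Closed m F c p := by
  have e := κ.alt.align hc h0 h1
  have hm := h.pa.hM _ _ hc.2
  have hm' := h.pa.hM _ _ κ.alt.2
  rw [← closed_sh h.pa.sym hc (by omega) k, e, hp, ← h.orb_cell κ t ht,
    closed_sh h.pa.sym κ.alt (by omega) t]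
  exact h.cell_closed κ

/-- a point with two active letters -/
def TL (F : ℕ → Perm Ω) (z : Ω) : Prop := ∃ i j, i ≠ j ∧ F i z ≠ z ∧ F j z ≠ z

theorem GC.not_TL (h : GC m f O F) (κ : Cell m f O) (t : ℕ) (s : ZMod 7) (hs : s ≠ 0) :
    ¬ TL F (Sum.inr (κ, t, s)) := by
  have key : ∀ d, F d (Sum.inr (κ, t, s)) ≠ Sum.inr (κ, t, s) → d = κ.c t := by
    intro d hd
    rcases h.cases d _ hd with ⟨z0, hz, _⟩ | ⟨κ', t', s', h1, h2, h3, h4⟩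
    · simp at hz
    · rcases κ'.g_cases t' s' h1 h2 with ⟨a, b, e⟩ | ⟨a, b, e⟩ | ⟨a, b, e⟩ | ⟨a, b, e⟩ | ⟨a, b, e⟩ <;>
      rw [e] at h4 <;>
      simp only [Sum.inl.injEq, Sum.inr.injEq, Prod.mk.injEq, reduceCtorEq] at h4
      · exact absurd h4.2.2 hs
      · exact absurd h4.2.2 hs
      · rw [h4.1, h4.2.1, h3]
  rintro ⟨i, j, hij, hi, hj⟩
  exact hij ((key i hi).trans (key j hj).symm)

theorem GC.key (h : GC m f O F) (d z) (hd : F d z ≠ z) (hz : TL F z) (hz' : TL F (F d z)) :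
    (∃ z0, z = Sum.inl z0 ∧ f d z0 ≠ z0) ∨
    (∃ (κ : Cell m f O) (t : ℕ), κ.L ≤ t ∧ t < 2 * κ.M ∧ d = κ.c t ∧ z = κ.P t ∧
      F d z = κ.P (t + 1)) := by
  rcases h.cases d z hd with h1 | ⟨κ, t, s, h1, h2, rfl, rfl⟩
  · exact Or.inl h1
  · right
    refine ⟨κ, t, h1, h2, rfl, ?_⟩
    have hs : s = 0 ∨ s = 1 := by
      by_contra hcon
      push Not at hcon
      simp only [Cell.g] at hz
      rw [if_neg hcon.1, if_neg hcon.2] at hz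
      exact h.not_TL κ t s hcon.1 hz
    have hst := h.step κ t s h1 h2
    rw [hst] at hz' ⊢
    have h10 : (1 : ZMod 7) ≠ 0 := by decide
    rcases hs with rfl | rfl
    · simp [Cell.g, h10]
    · exfalso
      have h20 : (1 + 1 : ZMod 7) ≠ 0 := by decide
      have h21 : (1 + 1 : ZMod 7) ≠ 1 := by decide
      simp only [Cell.g] at hz'
      rw [if_neg h20, if_neg h21] at hz'
      exact h.not_TL κ t _ h20 hz'

theorem Cell.P_cases (κ : Cell m f O) (t : ℕ) (h1 : κ.L ≤ t) (h2 : t ≤ 2 * κ.M) :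
    (t = κ.L ∧ κ.P t = Sum.inl (orb f κ.c κ.x κ.L)) ∨
    (κ.L < t ∧ t < 2 * κ.M ∧ κ.P t = Sum.inr (κ, t, 0)) ∨
    (t = 2 * κ.M ∧ κ.P t = Sum.inl κ.x) := by
  have := κ.L_lt
  by_cases ht : t = κ.L
  · left; refine ⟨ht, ?_⟩; subst ht; simp [Cell.P]
  · by_cases ht' : t < 2 * κ.M
    · right; left
      refine ⟨by omega, ht', ?_⟩
      simp only [Cell.P]; rw [if_neg (by omega), if_pos ht']
    · right; right
      refine ⟨by omega, ?_⟩
      simp only [Cell.P]; rw [if_neg (by omega), if_neg ht']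

/-- an old step of a run -/
def OldStep (f : ℕ → Perm Ω) (F : ℕ → Perm (Ω ⊕ (Cell m f O × ℕ × ZMod 7))) (c : ℕ → ℕ)
    (p : Ω ⊕ (Cell m f O × ℕ × ZMod 7)) (k : ℕ) : Prop :=
  ∃ z0, orb F c p k = Sum.inl z0 ∧ f (c k) z0 ≠ z0

/-- a cell step of a run -/
def CellStep (f : ℕ → Perm Ω) (F : ℕ → Perm (Ω ⊕ (Cell m f O × ℕ × ZMod 7))) (c : ℕ → ℕ)
    (p : Ω ⊕ (Cell m f O × ℕ × ZMod 7)) (k : ℕ) : Prop :=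
  ∃ (κ : Cell m f O) (t : ℕ), κ.L ≤ t ∧ t < 2 * κ.M ∧ c k = κ.c t ∧ orb F c p k = κ.P t ∧
      orb F c p (k + 1) = κ.P (t + 1)

theorem GC.pair_cell (h : GC m f O F) {c : ℕ → ℕ} (hc : Alt c) {p} {k : ℕ}
    (h1 : CellStep f F c p k) (h2 : OldStep f F c p (k + 1) ∨ CellStep f F c p (k + 1)) :
    Closed m F c p := by
  obtain ⟨κ, t, t1, t2, e1, e2, e3⟩ := h1
  have hlt := κ.L_lt
  refine h.aligned hc κ t2.le e2 e1 ?_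
  rcases κ.P_cases (t + 1) (by omega) (by omega) with ⟨a, b⟩ | ⟨a, a', b⟩ | ⟨a, b⟩
  · omega
  · rw [b] at e3
    rcases h2 with ⟨z0, g1, g2⟩ | ⟨κ', t', t1', t2', g1, g2, g3⟩
    · rw [g1] at e3; simp at e3
    · rw [e3] at g2
      rcases κ'.P_cases t' t1' t2'.le with ⟨u, v⟩ | ⟨u, u', v⟩ | ⟨u, v⟩ <;> rw [v] at g2 <;>
      simp only [Sum.inr.injEq, Prod.mk.injEq, reduceCtorEq] at g2
      rw [g1, ← g2.1, ← g2.2.1]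
  · rw [b] at e3
    rcases h2 with ⟨z0, g1, g2⟩ | ⟨κ', t', t1', t2', g1, g2, g3⟩
    · rw [g1] at e3
      have e4 := Sum.inl_injective e3
      rw [e4] at g2
      rw [κ.c_2M a]
      exact κ.x_act h.pa _ g2
    · rw [e3] at g2
      rcases κ'.P_cases t' t1' t2'.le with ⟨u, v⟩ | ⟨u, u', v⟩ | ⟨u, v⟩ <;> rw [v] at g2 
      · exact absurd (Sum.inl_injective g2) (κ.x_ne_y h.pa κ')
      · simp at g2
      · omega

theorem GC.pair_old (h : GC m f O F) {c : ℕ → ℕ} (hc : Alt c) {p} {k : ℕ}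
    (h1 : OldStep f F c p k) (h2 : CellStep f F c p (k + 1)) :
    Closed m F c p := by
  obtain ⟨κ, t, t1, t2, e1, e2, e3⟩ := h2
  obtain ⟨z0, g1, g2⟩ := h1
  have hlt := κ.L_lt
  have h4 := κ.L_ge h.pa
  refine h.aligned hc κ t2.le e2 e1 ?_
  have e4 : orb F c p (k + 1) = Sum.inl (f (c k) z0) := by
    simp only [orb]; rw [g1, h.old _ _ g2]
  rw [e4] at e2
  rcases κ.P_cases t t1 t2.le with ⟨a, b⟩ | ⟨a, a', b⟩ | ⟨a, b⟩
  · rw [b] at e2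
    have e5 := Sum.inl_injective e2
    have := κ.y_act h.pa (c k) (by rw [← e5]; exact fun h' => g2 ((f _).injective h'))
    rw [show k + 1 + 1 = k + 2 by ring, hc.1, this, ← κ.alt.1 (κ.L - 1)]
    congr 1; omega
  · rw [b] at e2; simp at e2
  · omega

theorem GC.complete (h : GC m f O F) : ∀ n L, n ≤ 2 → ∀ c x, Alt c →
    L + n = 2 * m (c 0) (c 1) → Run f c x L → Closed m F c (Sum.inl x) := by
  intro n
  induction n with
  | zero =>
    intro L _ c x hc hL hr
    exact transport_closed Sum.inl_injective h.old (h.pa.P3 c x hc (by rwa [← hL]))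
  | succ n ih =>
    intro L hn c x hc hL hr
    have hm := h.pa.hM _ _ hc.2
    by_cases h1 : orb f c x L ∈ O
    · refine ih (L + 1) (by omega) c x hc (by omega) ?_
      intro k hk
      by_cases hk' : k < L
      · exact hr k hk'
      · have : k = L := by omega
        subst this
        exact h.pa.P4 _ h1 _
    · by_cases h2 : x ∈ O
      · have hw : f (c 1) ((f (c 1))⁻¹ x) = x := by simp
        set w := (f (c 1))⁻¹ x with hwd
        have ha : f (c 1) w ≠ w := by
          intro h3
          rw [hw] at h3
          rw [← h3] at hw
          exact h.pa.P4 _ h2 _ hw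
        have e2 : sh 1 (sh 1 c) = c := by
          funext k; simp only [sh]; exact hc.1 k
        have e3 : sh 1 c 0 = c 1 := rfl
        have hcl := ih (L + 1) (by omega) (sh 1 c) w (hc.sh 1)
          (by rw [mm_sh h.pa.sym hc]; omega) (by
            apply Run.unshift
            · rw [e3]; exact ha
            · rw [e2, e3, hw]; exact hr)
        have := (closed_sh_one h.pa.sym (hc.sh 1) (by rw [mm_sh h.pa.sym hc]; omega)).2 hcl
        simp only [orb] at this
        rw [e2, e3, h.old _ _ ha, hw] at this
        exact this
      · exact h.cell_closed ⟨c, x, L, hc, h2, by omega, by omega, hr, h1⟩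

theorem GC.all_old (h : GC m f O F) {c p L} (hL : 0 < L) (ha : ∀ k < L, OldStep f F c p k) :
    ∃ q, p = Sum.inl q ∧ Run f c q L := by
  obtain ⟨q, hq, hq'⟩ := ha 0 hL
  refine ⟨q, hq, ?_⟩
  have hq0 : p = Sum.inl q := hq
  subst hq0
  have : ∀ k ≤ L, Run f c q k := by
    intro k
    induction k with
    | zero => intro _ k hk; omega
    | succ n ih =>
      intro hn k hk
      by_cases hk' : k < n
      · exact ih (by omega) k hk'
      · have : k = n := by omega
        subst this
        obtain ⟨z, h1, h2⟩ := ha k (by omega)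
        rw [transport h.old (ih (by omega)) k le_rfl] at h1
        rw [Sum.inl_injective h1]
        exact h2
  exact this L le_rfl

theorem GC.inv (h : GC m f O F) : Inv m F := by
  intro c p hc hr
  have hm := h.pa.hM _ _ hc.2
  set R := 2 * m (c 0) (c 1) - 2 with hR
  have hR4 : 4 ≤ R := by omega
  have hin : ∀ k, F (c k) (orb F c p k) ≠ orb F c p k →
      F (c k) (orb F c p (k + 1)) ≠ orb F c p (k + 1) :=
    fun k h1 h2 => h1 ((F (c k)).injective h2)
  have tl : ∀ k, 0 < k → k < R → TL F (orb F c p k) := by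
    intro k h0 h1
    obtain ⟨k, rfl⟩ : ∃ k', k = k' + 1 := ⟨k - 1, by omega⟩
    exact ⟨c k, c (k + 1), hc.ne k, hin k (hr k (by omega)), hr (k + 1) h1⟩
  have keys : ∀ k, 0 < k → k + 1 < R → OldStep f F c p k ∨ CellStep f F c p k := by
    intro k h0 h1
    exact h.key _ _ (hr k (by omega)) (tl k h0 (by omega)) (tl (k + 1) (by omega) h1)
  by_contra hncl
  have olds : ∀ k, 0 < k → k + 1 < R → OldStep f F c p k := by
    intro k h0 h1
    refine (keys k h0 h1).resolve_right fun hk => hncl ?_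
    by_cases hk2 : k + 2 < R
    · exact h.pair_cell hc hk (keys (k + 1) (by omega) (by omega))
    · obtain ⟨k, rfl⟩ : ∃ k', k = k' + 1 := ⟨k - 1, by omega⟩
      rcases keys k (by omega) (by omega) with h3 | h3
      · exact h.pair_old hc h3 hk
      · exact h.pair_cell hc h3 (Or.inr hk)
  -- the old orbit
  have inO : ∀ k, 0 < k → k + 2 < R → ∃ q, orb F c p (k + 1) = Sum.inl q ∧ q ∈ O := by
    intro k h0 h1
    obtain ⟨q1, a1, b1⟩ := olds k h0 (by omega)
    obtain ⟨q2, a2, b2⟩ := olds (k + 1) (by omega) (by omega)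
    refine ⟨q2, a2, ?_⟩
    by_contra hcon
    have e : q2 = f (c k) q1 := by
      apply Sum.inl_injective (β := Cell m f O × ℕ × ZMod 7)
      rw [← a2, ← h.old _ _ b1, ← a1]; rfl
    refine hc.ne k (h.pa.P1 _ hcon _ _ ?_ b2)
    rw [e]
    exact fun h' => b1 ((f _).injective h')
  have first : OldStep f F c p 0 := by
    rcases h.cases (c 0) (orb F c p 0) (hr 0 (by omega)) with h1 | ⟨κ, t, s, h1, h2, h3, h4⟩
    · exact h1
    · exfalso
      have hst := h.step κ t s h1 h2
      rw [← h4, ← h3] at hst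
      change orb F c p 1 = _ at hst
      obtain ⟨q1, a1, b1⟩ := olds 1 (by omega) (by omega)
      rw [a1] at hst
      have h4L := κ.L_ge h.pa
      rcases κ.g_cases t (s + 1) h1 h2 with ⟨a, b, e⟩ | ⟨a, b, e⟩ | ⟨a, b, e⟩ | ⟨a, b, e⟩ |
        ⟨a, b, e⟩ <;> rw [e] at hst
      · have e1 := Sum.inl_injective hst
        have e2 := κ.y_act h.pa (c 1) (by rw [← e1]; exact b1)
        obtain ⟨q2, a2, b2⟩ := inO 1 (by omega) (by omega)
        have e3 : q2 = f (c 1) q1 := by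
          apply Sum.inl_injective (β := Cell m f O × ℕ × ZMod 7)
          rw [← a2, ← h.old _ _ b1, ← a1]; rfl
        refine κ.hy (h.pa.P5 _ _ _ (interior h.pa.P1 κ.alt κ.run (k := κ.L - 1) (by omega)
          (by omega)) (κ.y_act' h.pa).2.symm ?_)
        rw [← e2, ← e1, ← e3]
        exact b2
      · have e1 := Sum.inl_injective hst
        have e2 := κ.x_act h.pa (c 1) (by rw [← e1]; exact b1)
        have hs : s = 0 := by simpa using a
        subst hs
        apply hncl
        refine h.aligned hc κ h2.le (k := 0) (t := t) ?_ h3 ?_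
        · rw [h4]; simp [Cell.g]
        · rw [κ.c_2M b, ← e2]
      · simp at hst
      · simp at hst
      · simp at hst
  have last : OldStep f F c p (R - 1) := by
    rcases h.cases (c (R - 1)) (orb F c p (R - 1)) (hr (R - 1) (by omega)) with
      h1 | ⟨κ, t, s, h1, h2, h3, h4⟩
    · exact h1
    · exfalso
      obtain ⟨q1, a1, b1⟩ := olds (R - 2) (by omega) (by omega)
      have a2 : orb F c p (R - 1) = Sum.inl (f (c (R - 2)) q1) := by
        rw [← h.old _ _ b1, ← a1, show R - 1 = R - 2 + 1 by omega]; rfl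
      have b2 : f (c (R - 2)) (f (c (R - 2)) q1) ≠ f (c (R - 2)) q1 :=
        fun h' => b1 ((f _).injective h')
      have h4L := κ.L_ge h.pa
      have h4' := h4
      rw [a2] at h4'
      rcases κ.g_cases t s h1 h2 with ⟨a, b, e⟩ | ⟨a, b, e⟩ | ⟨a, b, e⟩ | ⟨a, b, e⟩ |
        ⟨a, b, e⟩ <;> rw [e] at h4'
      · have e1 := Sum.inl_injective h4'
        have e2 := κ.y_act h.pa (c (R - 2)) (by rw [← e1]; exact b2)
        apply hncl
        refine h.aligned hc κ h2.le (k := R - 1) (t := t) ?_ h3 ?_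
        · rw [h4, a]; simp [Cell.g]
        · rw [show R - 1 + 1 = R - 2 + 2 by omega, hc.1, e2, ← κ.alt.1 (κ.L - 1), b]
          congr 1; omega
      · have e1 := Sum.inl_injective h4'
        have e2 := κ.x_act h.pa (c (R - 2)) (by rw [← e1]; exact b2)
        obtain ⟨q2, a3, b3⟩ := inO (R - 3) (by omega) (by omega)
        rw [show R - 3 + 1 = R - 2 by omega, a1] at a3
        rw [← Sum.inl_injective a3] at b3
        refine κ.hx (h.pa.P5 _ _ _ b3 e1 ?_)
        rw [e2]
        exact interior h.pa.P1 κ.alt κ.run (k := 1) (by omega) (by omega)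
      · simp at h4'
      · simp at h4'
      · simp at h4'
  obtain ⟨q, rfl, hq⟩ := h.all_old (c := c) (p := p) (L := R) (by omega) (by
    intro k hk
    by_cases hk0 : k = 0
    · subst hk0; exact first
    · by_cases hk1 : k = R - 1
      · subst hk1; exact last
      · exact olds k (by omega) (by omega))
  exact hncl (h.complete 2 R le_rfl c q hc (by omega) hq)

end stageC

theorem extension {Ω : Type} {m : ℕ → ℕ → ℕ} (hs : ∀ i j, m i j = m j i)
    (hM : ∀ i j, i ≠ j → 3 ≤ m i j) {f : ℕ → Perm Ω} (hf : ∀ i, f i ^ 7 = 1) (hI : Inv m f) :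
    ∃ (Ω' : Type) (f' : ℕ → Perm Ω') (ι : Ω → Ω'), Function.Injective ι ∧
      (∀ i, f' i ^ 7 = 1) ∧ Inv m f' ∧
      (∀ i x, f i x ≠ x → f' i (ι x) = ι (f i x)) ∧ (∀ i x, f' i (ι x) ≠ ι x) := by
  obtain ⟨Ω', f', ι, h1, h2, h3, h4⟩ := postA hs hM hf hI
  obtain ⟨F, h5, h6⟩ := exists_GC h4 h2
  refine ⟨_, F, fun x => Sum.inl (ι x), Sum.inl_injective.comp h1, h5, h6.inv, ?_, ?_⟩
  · intro i x hx
    rw [h6.old, h3 i x hx]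
    rw [h3 i x hx]
    exact fun h => hx (h1 h)
  · intro i x
    have := h4.P4 _ (Set.mem_range_self x) i
    rw [h6.old _ _ this]
    exact fun h => this (Sum.inl_injective h)

end GW

namespace GW
open Equiv

theorem Alt.parity {c : ℕ → ℕ} (h : Alt c) {k k' : ℕ} (hk : k % 2 = k' % 2) : c k = c k' := by
  have h1 := h.two_mul (k % 2) (k / 2)
  have h2 := h.two_mul (k' % 2) (k' / 2)
  rw [Nat.mod_add_div] at h1 h2
  rw [h1, h2, hk]

/-- all letters are active on a ball of radius `n` -/
def Good {Ω : Type} (f : ℕ → Perm Ω) : ℕ → Ω → Prop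
  | 0, _ => True
  | n + 1, y => ∀ i, f i y ≠ y ∧ Good f n y ∧ Good f n (f i y) ∧ Good f n ((f i)⁻¹ y)

theorem embed_good {m : ℕ → ℕ → ℕ} (hs : ∀ i j, m i j = m j i)
    (hM : ∀ i j, i ≠ j → 3 ≤ m i j) (n : ℕ) : ∀ {Ω : Type} {f : ℕ → Perm Ω},
    (∀ i, f i ^ 7 = 1) → Inv m f →
    ∃ (Ω' : Type) (f' : ℕ → Perm Ω') (ι : Ω → Ω'), Function.Injective ι ∧
      (∀ i, f' i ^ 7 = 1) ∧ Inv m f' ∧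
      (∀ i x, f i x ≠ x → f' i (ι x) = ι (f i x)) ∧ (∀ x, Good f' n (ι x)) := by
  induction n with
  | zero =>
    intro Ω f hf hI
    exact ⟨Ω, f, id, Function.injective_id, hf, hI, fun _ _ _ => rfl, fun _ => trivial⟩
  | succ n ih =>
    intro Ω f hf hI
    obtain ⟨Ω1, f1, ι1, a1, a2, a3, a4, a5⟩ := extension hs hM hf hI
    obtain ⟨Ω2, f2, ι2, b1, b2, b3, b4, b5⟩ := ih a2 a3
    refine ⟨Ω2, f2, ι2 ∘ ι1, b1.comp a1, b2, b3, ?_, ?_⟩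
    · intro i x hx
      simp only [Function.comp]
      rw [b4 _ _ (a5 i x), a4 i x hx]
    · intro x i
      have e1 := b4 _ _ (a5 i x)
      have e2 : f2 i (ι2 ((f1 i)⁻¹ (ι1 x))) = ι2 (ι1 x) := by
        have h1 : f1 i ((f1 i)⁻¹ (ι1 x)) = ι1 x := by simp
        rw [b4, h1]
        intro h2
        rw [h1] at h2
        rw [← h2] at h1
        exact a5 i x h1
      refine ⟨?_, b5 _, ?_, ?_⟩
      · simp only [Function.comp]
        rw [e1]
        exact fun h => a5 i x (b1 h)
      · simp only [Function.comp]
        rw [e1]; exact b5 _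
      · simp only [Function.comp]
        rw [show (f2 i)⁻¹ (ι2 (ι1 x)) = ι2 ((f1 i)⁻¹ (ι1 x)) by
          rw [Perm.inv_eq_iff_eq]; exact e2.symm]
        exact b5 _

theorem Good.run {Ω : Type} {f : ℕ → Perm Ω} {c : ℕ → ℕ} : ∀ {n : ℕ} {y : Ω},
    Good f n y → Run f c y n := by
  intro n
  induction n generalizing c with
  | zero => intro y _ k hk; omega
  | succ n ih =>
    intro y h
    exact Run.unshift (h (c 0)).1 (ih (h (c 0)).2.2.1)

theorem Good.mono {Ω : Type} {f : ℕ → Perm Ω} : ∀ {n : ℕ} {y : Ω},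
    Good f (n + 1) y → Good f n y := fun h => (h 0).2.1

theorem Good.mono' {Ω : Type} {f : ℕ → Perm Ω} {n k : ℕ} {y : Ω} (h : Good f k y) (hk : n ≤ k) :
    Good f n y := by
  induction k with
  | zero => 
    have : n = 0 := by omega
    subst this; exact h
  | succ k ih =>
    by_cases hh : n ≤ k
    · exact ih h.mono hh
    · have : n = k + 1 := by omega
      subst this; exact h

theorem good_move (g : FreeGroup ℕ) : ∃ k, ∀ (Ω : Type) (f : ℕ → Perm Ω) (n : ℕ) (y : Ω),
    Good f (n + k) y → Good f n (FreeGroup.lift f g y) := by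
  induction g using FreeGroup.induction_on with
  | C1 => exact ⟨0, fun Ω f n y h => by simpa using h⟩
  | of i => exact ⟨1, fun Ω f n y h => by simpa using (h i).2.2.1⟩
  | inv_of i _ => exact ⟨1, fun Ω f n y h => by simpa using (h i).2.2.2⟩
  | mul a b ha hb =>
    obtain ⟨k, hk⟩ := ha
    obtain ⟨l, hl⟩ := hb
    refine ⟨k + l, fun Ω f n y h => ?_⟩
    rw [map_mul, Perm.mul_apply]
    exact hk _ _ _ _ (hl _ _ _ _ (by rwa [add_assoc]))

theorem alt_pow {Ω : Type} {f : ℕ → Perm Ω} (i j : ℕ) (y : Ω) (M : ℕ) :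
    ((f i * f j) ^ M) y = orb f (fun k => if k % 2 = 0 then j else i) y (2 * M) := by
  induction M with
  | zero => rfl
  | succ n ih =>
    rw [pow_succ', Perm.mul_apply, ih, show 2 * (n + 1) = 2 * n + 1 + 1 by ring]
    simp only [orb]
    rw [if_neg (by omega), if_pos (by omega)]
    rfl

theorem alt_if {i j : ℕ} (h : i ≠ j) : Alt (fun k => if k % 2 = 0 then j else i) := by
  refine ⟨fun k => ?_, ?_⟩
  · simp
  · simpa using h.symm

section
variable (T : SimpleGraph ℕ)

open Classical in
/-- the exponent of the relator -/
noncomputable def mT (i j : ℕ) : ℕ := if T.Adj i j then 11 else 13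

theorem mT_sym (i j : ℕ) : mT T i j = mT T j i := by
  by_cases h : T.Adj i j
  · simp [mT, h, h.symm]
  · have h' : ¬ T.Adj j i := fun h' => h h'.symm
    simp [mT, h, h']

theorem mT_ge (i j : ℕ) : 11 ≤ mT T i j := by
  unfold mT; split_ifs <;> omega

theorem rel_trivial (w : FreeGroup ℕ) (hw : w ∈ Subgroup.normalClosure (grRels T.Adj)) :
    ∃ n, ∀ (Ω : Type) (f : ℕ → Perm Ω), (∀ i, f i ^ 7 = 1) → Inv (mT T) f →
      ∀ y, Good f n y → FreeGroup.lift f w y = y := by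
  have pairs : ∀ i j, i ≠ j → ∃ n, ∀ (Ω : Type) (f : ℕ → Perm Ω), (∀ i, f i ^ 7 = 1) →
      Inv (mT T) f → ∀ y, Good f n y →
      FreeGroup.lift f ((FreeGroup.of i * FreeGroup.of j) ^ (mT T i j)) y = y := by
    intro i j hij
    refine ⟨2 * mT T j i - 2, fun Ω f hf hI y hy => ?_⟩
    have := hI _ y (alt_if hij) (Good.run (by simpa using hy))
    have h2 := this.2
    simp only [map_pow, map_mul, FreeGroup.lift_apply_of]
    rw [alt_pow, mT_sym]
    simpa using h2
  unfold Subgroup.normalClosure at hw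
  induction hw using Subgroup.closure_induction with
  | mem x hx =>
    rw [Group.mem_conjugatesOfSet_iff] at hx
    obtain ⟨a, ha, hx⟩ := hx
    rw [isConj_iff] at hx
    obtain ⟨g, rfl⟩ := hx
    have key : ∃ n, ∀ (Ω : Type) (f : ℕ → Perm Ω), (∀ i, f i ^ 7 = 1) →
        Inv (mT T) f → ∀ y, Good f n y → FreeGroup.lift f a y = y := by
      rcases ha with ⟨i, rfl⟩ | ⟨i, j, hij, rfl⟩ | ⟨i, j, hij, hij', rfl⟩
      · exact ⟨0, fun Ω f hf _ y _ => by simp [hf]⟩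
      · have := pairs i j hij.ne
        have e : mT T i j = 11 := by simp [mT, hij]
        rwa [e] at this
      · have := pairs i j hij
        have e : mT T i j = 13 := by simp [mT, hij']
        rwa [e] at this
    obtain ⟨n, hn⟩ := key
    obtain ⟨k, hk⟩ := good_move g⁻¹
    refine ⟨n + k, fun Ω f hf hI y hy => ?_⟩
    rw [map_mul, map_mul, Perm.mul_apply, Perm.mul_apply, hn Ω f hf hI _ (hk _ _ _ _ hy)]
    simp
  | one => exact ⟨0, fun Ω f _ _ y _ => by simp⟩
  | mul a b _ _ ha hb =>
    obtain ⟨k, hk⟩ := ha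
    obtain ⟨l, hl⟩ := hb
    refine ⟨k + l, fun Ω f hf hI y hy => ?_⟩
    rw [map_mul, Perm.mul_apply, hl Ω f hf hI y (hy.mono' (by omega)),
      hk Ω f hf hI y (hy.mono' (by omega))]
  | inv a _ ha =>
    obtain ⟨k, hk⟩ := ha
    refine ⟨k, fun Ω f hf hI y hy => ?_⟩
    rw [map_inv, Perm.inv_eq_iff_eq]
    exact (hk Ω f hf hI y hy).symm

end

/-- products of consecutive elements of a sequence -/
def seg {G : Type} [Group G] (u : ℕ → G) (o : ℕ) : ℕ → G
  | 0 => 1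
  | n + 1 => seg u o n * u (o + n)

theorem map_seg {G H : Type} [Group G] [Group H] (φ : G →* H) (u : ℕ → G) (o n : ℕ) :
    φ (seg u o n) = seg (fun k => φ (u k)) o n := by
  induction n with
  | zero => simp [seg]
  | succ n ih => simp [seg, ih]

/-- a periodic alternating window of the word `W` -/
def Win (m : ℕ → ℕ → ℕ) (W : ℕ → ℕ × ZMod 7) (n : ℕ) : Prop :=
  ∃ c ε o, Alt c ∧ (ε = 1 ∨ ε = -1) ∧ o + (2 * m (c 0) (c 1) - 4) ≤ n ∧
    ∀ k < 2 * m (c 0) (c 1) - 4, W (o + k) = (c k, ε)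

theorem base {m : ℕ → ℕ → ℕ} (hs : ∀ i j, m i j = m j i) (hM : ∀ i j, 3 ≤ m i j)
    (W : ℕ → ℕ × ZMod 7) (n : ℕ) (h0 : ∀ k < n, (W k).2 ≠ 0)
    (h1 : ∀ k, k + 1 < n → (W k).1 ≠ (W (k + 1)).1) (hW : ¬ Win m W n) :
    ∃ (Ω : Type) (f : ℕ → Perm Ω) (x : ℕ → Ω), (∀ i, f i ^ 7 = 1) ∧ Inv m f ∧
      Function.Injective x ∧ (∀ k < n, f (W k).1 (x (k + 1)) ≠ x (k + 1)) ∧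
      (∀ k < n, (f (W k).1 ^ (W k).2.val) (x (k + 1)) = x k) := by
  classical
  let K := Fin n
  let g : ℕ → ZMod 7 → ℕ ⊕ (ℕ × ZMod 7) := fun k s =>
    if s = 0 then Sum.inl (k + 1) else if s = (W k).2 then Sum.inl k else Sum.inr (k, s)
  have gc : ∀ k s, (s = 0 ∧ g k s = Sum.inl (k + 1)) ∨ (s = (W k).2 ∧ g k s = Sum.inl k) ∨
      (s ≠ 0 ∧ g k s = Sum.inr (k, s)) := by
    intro k s
    by_cases a : s = 0
    · left; exact ⟨a, by simp only [g]; rw [if_pos a]⟩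
    · right
      by_cases b : s = (W k).2
      · left; exact ⟨b, by simp only [g]; rw [if_neg a, if_pos b]⟩
      · right; exact ⟨a, by simp only [g]; rw [if_neg a, if_neg b]⟩
  have ginj : ∀ k k' s s', k < n → k' < n → (W k).1 = (W k').1 → g k s = g k' s' →
      k = k' ∧ s = s' := by
    intro k k' s s' hk hk' hl h
    rcases gc k s with ⟨a, e⟩ | ⟨a, e⟩ | ⟨a, e⟩ <;> rcases gc k' s' with ⟨a', e'⟩ | ⟨a', e'⟩ | ⟨a', e'⟩ <;>
    rw [e, e'] at h <;>
    simp only [Sum.inl.injEq, Sum.inr.injEq, Prod.mk.injEq, reduceCtorEq] at h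
    · exact ⟨by omega, a.trans a'.symm⟩
    · subst h; exact absurd hl (h1 k hk')
    · subst h; exact absurd hl.symm (h1 k' hk)
    · subst h; exact ⟨rfl, a.trans a'.symm⟩
    · exact h
  obtain ⟨f, f7, fg, fn⟩ := glue (fun _ => (1 : Perm (ℕ ⊕ (ℕ × ZMod 7)))) (fun _ => one_pow 7)
    (fun k : K => (W k.1).1) (fun k : K => g k.1) (by
      rintro ⟨k, hk⟩ ⟨k', hk'⟩ s s' hl h
      obtain ⟨rfl, rfl⟩ := ginj k k' s s' hk hk' hl h
      exact ⟨rfl, rfl⟩) (fun _ _ => rfl)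
  have fg' : ∀ k s, k < n → f (W k).1 (g k s) = g k (s + 1) := fun k s hk => fg ⟨k, hk⟩ s
  have g0 : ∀ k, g k 0 = Sum.inl (k + 1) := fun k => by simp [g]
  have gW : ∀ k < n, g k (W k).2 = Sum.inl k := fun k hk => by simp [g, h0 k hk]
  have fcases : ∀ d z, f d z ≠ z → ∃ k s, k < n ∧ d = (W k).1 ∧ z = g k s := by
    intro d z hz
    by_contra hcon
    push Not at hcon
    apply hz
    rw [fn d z]
    · rfl
    · rintro ⟨k, hk⟩ s e1 e2
      exact hcon k s hk e1.symm e2.symm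
  have fact : ∀ k s, k < n → f (W k).1 (g k s) ≠ g k s := by
    intro k s hk h
    rw [fg' k s hk] at h
    have := (ginj k k _ _ hk hk rfl h).2
    have h10 : (1 : ZMod 7) ≠ 0 := by decide
    exact h10 (by simpa using this)
  have tl : ∀ z, TL f z → ∃ k, z = Sum.inl k := by
    rintro (k | ⟨k, s⟩) ⟨i, j, hij, hi, hj⟩
    · exact ⟨k, rfl⟩
    · exfalso
      have key : ∀ d, f d (Sum.inr (k, s)) ≠ Sum.inr (k, s) → d = (W k).1 := by
        intro d hd
        obtain ⟨k', s', b1, b2, b3⟩ := fcases d _ hd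
        rcases gc k' s' with ⟨a, e⟩ | ⟨a, e⟩ | ⟨a, e⟩ <;> rw [e] at b3 <;>
        simp only [Sum.inr.injEq, Prod.mk.injEq, reduceCtorEq] at b3
        rw [b3.1, b2]
      exact hij ((key i hi).trans (key j hj).symm)
  have keyst : ∀ d z z', f d (Sum.inl z) = Sum.inl z' → z ≠ z' →
      (z' < n ∧ z = z' + 1 ∧ d = (W z').1 ∧ (W z').2 = 1) ∨
      (z < n ∧ z' = z + 1 ∧ d = (W z).1 ∧ (W z).2 = -1) := by
    intro d z z' h hne
    obtain ⟨k, s, b1, b2, b3⟩ := fcases d (Sum.inl z) (by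
      rw [h]; exact fun h' => hne (Sum.inl_injective h').symm)
    rw [b2, b3, fg' k s b1] at h
    rcases gc k s with ⟨a, e⟩ | ⟨a, e⟩ | ⟨a, e⟩ <;>
    rcases gc k (s + 1) with ⟨a', e'⟩ | ⟨a', e'⟩ | ⟨a', e'⟩ <;>
    rw [e] at b3 <;> rw [e'] at h <;>
    simp only [Sum.inl.injEq, reduceCtorEq] at b3 h
    · omega
    · left
      subst h
      refine ⟨b1, b3, b2, ?_⟩
      rw [← a', a, zero_add]
    · right
      subst b3
      refine ⟨b1, h.symm, b2, ?_⟩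
      rw [← a]; exact eq_neg_of_add_eq_zero_left a'
    · omega
  refine ⟨_, f, Sum.inl, f7, ?_, Sum.inl_injective, ?_, ?_⟩
  · intro c p hc hr
    exfalso
    apply hW
    have hm := hM (c 0) (c 1)
    set R := 2 * m (c 0) (c 1) - 2 with hR
    have hin : ∀ k, f (c k) (orb f c p k) ≠ orb f c p k →
        f (c k) (orb f c p (k + 1)) ≠ orb f c p (k + 1) :=
      fun k h1 h2 => h1 ((f (c k)).injective h2)
    have pt : ∀ k, ∃ j, 0 < k → k < R → orb f c p k = Sum.inl j := by
      intro k
      by_cases hk : 0 < k ∧ k < R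
      · obtain ⟨k, rfl⟩ : ∃ k', k = k' + 1 := ⟨k - 1, by omega⟩
        obtain ⟨j, hj⟩ := tl _ ⟨c k, c (k + 1), hc.ne k, hin k (hr k (by omega)), hr (k + 1) hk.2⟩
        exact ⟨j, fun _ _ => hj⟩
      · exact ⟨0, fun a b => absurd ⟨a, b⟩ hk⟩
    choose J hJ using pt
    have st : ∀ k, 0 < k → k + 1 < R →
      (J (k + 1) < n ∧ J k = J (k + 1) + 1 ∧ c k = (W (J (k + 1))).1 ∧ (W (J (k + 1))).2 = 1) ∨
      (J k < n ∧ J (k + 1) = J k + 1 ∧ c k = (W (J k)).1 ∧ (W (J k)).2 = -1) := by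
      intro k a b
      have e1 := hJ k a (by omega)
      have e2 := hJ (k + 1) (by omega) b
      apply keyst
      · rw [← e1, ← e2]; rfl
      · intro h
        apply hr k (by omega)
        rw [h, ← e2] at e1
        exact e1.symm
    -- the direction is constant
    rcases st 1 (by omega) (by omega) with hd | hd
    · have all : ∀ k, 0 < k → k + 1 < R → (J (k + 1) < n ∧ J k = J (k + 1) + 1 ∧
          c k = (W (J (k + 1))).1 ∧ (W (J (k + 1))).2 = 1) := by
        intro k
        induction k with
        | zero => intro a; omega
        | succ k ih =>
          intro _ b
          by_cases hk : k = 0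
          · subst hk; exact hd
          · have i1 := ih (by omega) (by omega)
            refine (st (k + 1) (by omega) b).resolve_right ?_
            rintro ⟨_, _, e, _⟩
            exact hc.ne k (i1.2.2.1.trans e.symm)
      have Jv : ∀ k, k ≤ R - 2 → J (1 + k) + k = J 1 := by
        intro k
        induction k with
        | zero => intro _; rfl
        | succ k ih =>
          intro hk
          have := (all (1 + k) (by omega) (by omega)).2.1
          have := ih (by omega)
          rw [show 1 + (k + 1) = 1 + k + 1 by ring]
          omega
      refine ⟨c, 1, J 1 - (R - 2), hc, Or.inl rfl, ?_, ?_⟩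
      · have := Jv (R - 2) le_rfl
        have := (all 1 (by omega) (by omega)).1
        have := Jv 1 (by omega)
        norm_num at this
        omega
      · intro k hk
        have j0 := Jv (R - 2) le_rfl
        have j1 := Jv (R - 2 - k) (by omega)
        have e := all (R - 2 - k) (by omega) (by omega)
        rw [show R - 2 - k + 1 = 1 + (R - 2 - k) by ring] at e
        rw [show J 1 - (R - 2) + k = J (1 + (R - 2 - k)) by omega]
        ext1
        · rw [← e.2.2.1]
          exact hc.parity (by omega)
        · exact e.2.2.2
    · have all : ∀ k, 0 < k → k + 1 < R → (J k < n ∧ J (k + 1) = J k + 1 ∧ c k = (W (J k)).1 ∧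
          (W (J k)).2 = -1) := by
        intro k
        induction k with
        | zero => intro a; omega
        | succ k ih =>
          intro _ b
          by_cases hk : k = 0
          · subst hk; exact hd
          · have i1 := ih (by omega) (by omega)
            refine (st (k + 1) (by omega) b).resolve_left ?_
            rintro ⟨_, e0, e, _⟩
            have : J (k + 1 + 1) = J k := by omega
            rw [this] at e
            exact hc.ne k (i1.2.2.1.trans e.symm)
      have Jv : ∀ k, k ≤ R - 2 → J (1 + k) = J 1 + k := by
        intro k
        induction k with
        | zero => intro _; rfl
        | succ k ih =>
          intro hk
          have := (all (1 + k) (by omega) (by omega)).2.1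
          have := ih (by omega)
          rw [show 1 + (k + 1) = 1 + k + 1 by ring]
          omega
      have ec : m (sh 1 c 0) (sh 1 c 1) = m (c 0) (c 1) := mm_sh hs hc 1
      refine ⟨sh 1 c, -1, J 1, hc.sh 1, Or.inr rfl, ?_, ?_⟩
      · rw [ec]
        have := (all (1 + (R - 3)) (by omega) (by omega)).1
        have := Jv (R - 3) (by omega)
        omega
      · intro k hk
        rw [ec] at hk
        have e := all (1 + k) (by omega) (by omega)
        rw [Jv k (by omega)] at e
        ext1
        · rw [← e.2.2.1]; simp only [sh]; rw [add_comm]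
        · exact e.2.2.2
  · intro k hk
    rw [← g0]; exact fact k 0 hk
  · intro k hk
    have : ∀ s : ℕ, (f (W k).1 ^ s) (g k 0) = g k s := by
      intro s
      induction s with
      | zero => simp
      | succ s ih => rw [pow_succ', Perm.mul_apply, ih, fg' k _ hk]; push_cast; rfl
    rw [← g0, this, ZMod.natCast_zmod_val, gW k hk]

/-- the value of a syllable -/
noncomputable def vv (T : SimpleGraph ℕ) (q : ℕ × ZMod 7) : GT T.Adj := gen T.Adj q.1 ^ q.2.val

theorem glThm (T : SimpleGraph ℕ) (W : ℕ → ℕ × ZMod 7) (n : ℕ) (hn : 0 < n)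
    (h0 : ∀ k < n, (W k).2 ≠ 0)
    (h1 : ∀ k, k + 1 < n → (W k).1 ≠ (W (k + 1)).1)
    (h : seg (fun k => vv T (W k)) 0 n = 1) : Win (mT T) W n := by
  by_contra hW
  obtain ⟨Ω, f, x, f7, fI, xi, fa, fs⟩ := base (mT_sym T)
    (fun i j => by have := mT_ge T i j; omega) W n h0 h1 hW
  set w : FreeGroup ℕ := seg (fun k => FreeGroup.of (W k).1 ^ (W k).2.val) 0 n with hw
  have hw1 : w ∈ Subgroup.normalClosure (grRels T.Adj) := by
    rw [← PresentedGroup.mk_eq_one_iff, hw, map_seg, ← h]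
    rfl
  obtain ⟨N, hN⟩ := rel_trivial T w hw1
  obtain ⟨Ω', f', ι, a1, a2, a3, a4, a5⟩ := embed_good (mT_sym T)
    (fun i j _ => by have := mT_ge T i j; omega) N f7 fI
  have e := hN Ω' f' a2 a3 _ (a5 (x n))
  rw [hw, map_seg] at e
  simp only [map_pow, FreeGroup.lift_apply_of] at e
  have key : ∀ k ≤ n, seg (fun k => f' (W k).1 ^ (W k).2.val) 0 k (ι (x k)) = ι (x 0) := by
    intro k
    induction k with
    | zero => intro _; rfl
    | succ k ih =>
      intro hk
      have pw : ∀ s : ℕ, (f' (W k).1 ^ s) (ι (x (k + 1))) = ι ((f (W k).1 ^ s) (x (k + 1))) := by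
        intro s
        induction s with
        | zero => rfl
        | succ s ih =>
          rw [pow_succ', Perm.mul_apply, ih, a4, pow_succ', Perm.mul_apply]
          rw [← Perm.mul_apply, ← pow_succ', pow_succ, Perm.mul_apply]
          exact fun h' => fa k hk ((f (W k).1 ^ s).injective h')
      simp only [seg, Perm.mul_apply]
      rw [zero_add, pw, fs k hk]
      exact ih (by omega)
  rw [key n le_rfl] at e
  have := xi (a1 e)
  omega

end GW

namespace GW

section seglemmas
variable {G : Type} [Group G]

theorem seg_add (u : ℕ → G) (o n k : ℕ) : seg u o (n + k) = seg u o n * seg u (o + n) k := by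
  induction k with
  | zero => simp [seg]
  | succ k ih => rw [← add_assoc]; simp only [seg]; rw [ih, mul_assoc, add_assoc]

theorem seg_congr {u u' : ℕ → G} {o o' n : ℕ} (h : ∀ k < n, u (o + k) = u' (o' + k)) :
    seg u o n = seg u' o' n := by
  induction n with
  | zero => rfl
  | succ n ih =>
    simp only [seg]
    rw [ih (fun k hk => h k (by omega)), h n (by omega)]

theorem seg_one (u : ℕ → G) (o : ℕ) : seg u o 1 = u o := by simp [seg]

theorem seg_two (u : ℕ → G) (o : ℕ) : seg u o 2 = u o * u (o + 1) := by simp [seg]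

theorem seg_inv (u : ℕ → G) (d : ℕ) : seg (fun i => (u (d - 1 - i))⁻¹) 0 d = (seg u 0 d)⁻¹ := by
  induction d with
  | zero => simp [seg]
  | succ d ih =>
    rw [add_comm d 1, seg_add, seg_one]
    rw [show (seg u 0 (1 + d))⁻¹ = (u d)⁻¹ * (seg u 0 d)⁻¹ by
      rw [add_comm 1 d]; simp [seg]]
    rw [← ih]
    congr 1
    · congr 2; omega
    · apply seg_congr
      intro k hk
      congr 2; omega

theorem seg_period (u : ℕ → G) (p : ℕ) (h : ∀ k, u (k + p) = u k) (n : ℕ) :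
    seg u 0 (p * n) = seg u 0 p ^ n := by
  have hp : ∀ n k, u (k + p * n) = u k := by
    intro n
    induction n with
    | zero => intro k; simp
    | succ n ih => intro k; rw [mul_add, mul_one, ← add_assoc, h, ih]
  induction n with
  | zero => simp [seg]
  | succ n ih =>
    rw [mul_add, mul_one, seg_add, ih, pow_succ]
    congr 1
    apply seg_congr
    intro k _
    rw [zero_add, zero_add, add_comm, hp]

theorem seg_alt (u : ℕ → G) (h : ∀ k, u (k + 2) = u k) (n : ℕ) :
    seg u 0 (2 * n) = (u 0 * u 1) ^ n := by
  rw [seg_period u 2 h, seg_two]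

end seglemmas

/-- word length at most `n` -/
inductive LenLE {G : Type} [Group G] (v : ℕ × ZMod 7 → G) : G → ℕ → Prop
  | nil : LenLE v 1 0
  | snoc (g : G) (n : ℕ) (q : ℕ × ZMod 7) : LenLE v g n → LenLE v (g * v q) (n + 1)

/-- the abstract properties of the groups used below -/
structure WG {G : Type} [Group G] (m : ℕ → ℕ → ℕ) (v : ℕ × ZMod 7 → G) : Prop where
  sym : ∀ i j, m i j = m j i
  hm : ∀ i j, m i j = 11 ∨ m i j = 13
  add : ∀ i a b, v (i, a + b) = v (i, a) * v (i, b)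
  rel : ∀ i j, i ≠ j → (v (i, 1) * v (j, 1)) ^ (m i j) = 1
  gl : ∀ W n, 0 < n → (∀ k < n, (W k).2 ≠ 0) → (∀ k, k + 1 < n → (W k).1 ≠ (W (k + 1)).1) →
    seg (fun k => v (W k)) 0 n = 1 → Win m W n
  span : ∀ g, ∃ n, LenLE v g n

namespace WG
variable {G : Type} [Group G] {m : ℕ → ℕ → ℕ} {v : ℕ × ZMod 7 → G}

theorem zero (h : WG m v) (i : ℕ) : v (i, 0) = 1 := by
  have := h.add i 0 0
  simpa using this

theorem neg (h : WG m v) (i : ℕ) (a : ZMod 7) : v (i, -a) = (v (i, a))⁻¹ := by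
  rw [eq_inv_iff_mul_eq_one, ← h.add]; simp [h.zero]

theorem pow (h : WG m v) (i : ℕ) (a : ZMod 7) (n : ℕ) : v (i, a) ^ n = v (i, n * a) := by
  induction n with
  | zero => simp [h.zero]
  | succ n ih => rw [pow_succ, ih, ← h.add]; congr 2; push_cast; ring

theorem pow7 (h : WG m v) (i : ℕ) (a : ZMod 7) : v (i, a) ^ 7 = 1 := by
  rw [h.pow, show ((7 : ℕ) : ZMod 7) = 0 by decide, zero_mul, h.zero]

theorem comm (h : WG m v) (i : ℕ) (a b : ZMod 7) : v (i, a) * v (i, b) = v (i, b) * v (i, a) := by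
  rw [← h.add, ← h.add, add_comm]

theorem mpos (h : WG m v) (i j : ℕ) : 11 ≤ m i j := by
  rcases h.hm i j with e | e <;> omega

theorem m7 (h : WG m v) (i j : ℕ) {g : G} (h7 : g ^ 7 = 1) (hg : g ^ (m i j) = 1) : g = 1 := by
  have h1 := orderOf_dvd_of_pow_eq_one h7
  have h2 := orderOf_dvd_of_pow_eq_one hg
  have h3 := Nat.dvd_gcd h1 h2
  rw [← orderOf_eq_one_iff, ← Nat.dvd_one]
  rcases h.hm i j with e | e <;> rw [e] at h3 <;> norm_num at h3 <;> simp [h3]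

theorem len_mul {g g' : G} {n k : ℕ} (h1 : LenLE v g n) (h2 : LenLE v g' k) :
    LenLE v (g * g') (n + k) := by
  induction h2 with
  | nil => simpa using h1
  | snoc g' k q _ ih => rw [← mul_assoc, ← add_assoc]; exact LenLE.snoc _ _ _ ih

theorem len_one (q : ℕ × ZMod 7) : LenLE v (v q) 1 := by
  simpa using LenLE.snoc _ _ q (LenLE.nil (v := v))

theorem len_inv (h : WG m v) {g : G} {n : ℕ} (h1 : LenLE v g n) : LenLE v g⁻¹ n := by
  induction h1 with
  | nil => simpa using LenLE.nil
  | snoc g n q _ ih =>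
    rw [mul_inv_rev, ← h.neg, add_comm]
    exact len_mul (len_one _) ih

theorem len_seg (W : ℕ → ℕ × ZMod 7) (o n : ℕ) : LenLE v (seg (fun k => v (W k)) o n) n := by
  induction n with
  | zero => exact LenLE.nil
  | succ n ih => exact LenLE.snoc _ _ _ ih

theorem len_exists {g : G} {n : ℕ} (h1 : LenLE v g n) :
    ∃ W : ℕ → ℕ × ZMod 7, seg (fun k => v (W k)) 0 n = g := by
  induction h1 with
  | nil => exact ⟨fun _ => (0, 0), rfl⟩
  | snoc g n q _ ih =>
    obtain ⟨W, hW⟩ := ih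
    refine ⟨fun k => if k < n then W k else q, ?_⟩
    simp only [seg]
    rw [zero_add, if_neg (lt_irrefl n)]
    congr 1
    rw [← hW]
    apply seg_congr
    intro k hk
    rw [zero_add, if_pos hk]

theorem window_rel (h : WG m v) {c : ℕ → ℕ} (hc : Alt c) {ε : ZMod 7} (hε : ε = 1 ∨ ε = -1) :
    (v (c 0, ε) * v (c 1, ε)) ^ (m (c 0) (c 1)) = 1 := by
  rcases hε with rfl | rfl
  · exact h.rel _ _ hc.2
  · rw [h.neg, h.neg, ← mul_inv_rev, inv_pow, h.sym, h.rel _ _ hc.2.symm, inv_one]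

theorem window_short (h : WG m v) {c : ℕ → ℕ} (hc : Alt c) {ε : ZMod 7} (hε : ε = 1 ∨ ε = -1)
    {W : ℕ → ℕ × ZMod 7} {o : ℕ} (hW : ∀ k < m (c 0) (c 1) + 1, W (o + k) = (c k, ε)) :
    LenLE v (seg (fun k => v (W k)) o (m (c 0) (c 1) + 1)) (m (c 0) (c 1) - 1) := by
  have hp := h.mpos (c 0) (c 1)
  set M := m (c 0) (c 1) with hM
  have e1 : seg (fun k => v (W k)) o (M + 1) = seg (fun k => v (c k, ε)) 0 (M + 1) := by
    apply seg_congr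
    intro k hk
    rw [hW k hk, zero_add]
  have e2 : seg (fun k => v (c k, ε)) 0 (2 * M) = 1 := by
    rw [seg_alt _ (fun k => by rw [hc.1])]
    exact h.window_rel hc hε
  rw [show 2 * M = (M + 1) + (M - 1) by omega, seg_add] at e2
  rw [e1, eq_inv_of_mul_eq_one_left e2]
  exact h.len_inv (len_seg (fun k => (c k, ε)) _ _)

theorem replace {u : ℕ → ℕ × ZMod 7} {o n p q q' : ℕ} (hpq : p + q ≤ n)
    (hl : LenLE v (seg (fun k => v (u k)) (o + p) q) q') :
    LenLE v (seg (fun k => v (u k)) o n) (n - q + q') := by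
  obtain ⟨r, rfl⟩ : ∃ r, n = p + q + r := ⟨n - (p + q), by omega⟩
  rw [seg_add, seg_add, show p + q + r - q + q' = p + q' + r by omega]
  exact len_mul (len_mul (len_seg _ _ _) hl) (len_seg _ _ _)

/-- minimal words are reduced -/
theorem min_red (h : WG m v) {W : ℕ → ℕ × ZMod 7} {o n : ℕ}
    (hmin : ∀ n' < n, ¬ LenLE v (seg (fun k => v (W k)) o n) n') :
    (∀ k < n, (W (o + k)).2 ≠ 0) ∧ (∀ k, k + 1 < n → (W (o + k)).1 ≠ (W (o + k + 1)).1) ∧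
    (∀ c ε p, Alt c → (ε = 1 ∨ ε = -1) → p + (m (c 0) (c 1) + 1) ≤ n →
      ¬ ∀ k < m (c 0) (c 1) + 1, W (o + p + k) = (c k, ε)) := by
  refine ⟨?_, ?_, ?_⟩
  · intro k hk h0
    refine hmin _ ?_ (replace (p := k) (q := 1) (q' := 0) hk ?_)
    · omega
    · rw [seg_one, show W (o + k) = ((W (o + k)).1, 0) by rw [← h0], h.zero]
      exact LenLE.nil
  · intro k hk h0
    refine hmin _ ?_ (replace (p := k) (q := 2) (q' := 1) hk ?_)
    · omega
    · rw [seg_two, show v (W (o + k)) * v (W (o + k + 1)) =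
        v ((W (o + k)).1, (W (o + k)).2 + (W (o + k + 1)).2) by rw [h.add]; congr 2; rw [h0]]
      exact len_one _
  · intro c ε p hc hε hp hw
    have hmp := h.mpos (c 0) (c 1)
    refine hmin _ ?_ (replace hp (h.window_short hc hε hw))
    omega

theorem short (h : WG m v) {W : ℕ → ℕ × ZMod 7} {n : ℕ} (hn : 0 < n) (hn' : n < 18)
    (h0 : ∀ k < n, (W k).2 ≠ 0) (h1 : ∀ k, k + 1 < n → (W k).1 ≠ (W (k + 1)).1) :
    seg (fun k => v (W k)) 0 n ≠ 1 := by
  intro h2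
  obtain ⟨c, ε, o, -, -, h3, -⟩ := h.gl W n hn h0 h1 h2
  have := h.mpos (c 0) (c 1)
  omega

theorem ne1 (h : WG m v) {a : ℕ} {x : ZMod 7} (hx : x ≠ 0) : v (a, x) ≠ 1 := by
  have := h.short (W := fun _ => (a, x)) (n := 1) (by omega) (by omega) (fun _ _ => hx)
    (fun k hk => by omega)
  rwa [seg_one] at this

theorem ne2 (h : WG m v) {a b : ℕ} {x y : ZMod 7} (hab : a ≠ b) (hx : x ≠ 0) (hy : y ≠ 0) :
    v (a, x) * v (b, y) ≠ 1 := by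
  have := h.short (W := fun k => if k = 0 then (a, x) else (b, y)) (n := 2) (by omega) (by omega)
    (fun k _ => by split_ifs <;> assumption)
    (fun k hk => by
      have : k = 0 := by omega
      subst this; simpa using hab)
  rw [seg_two] at this
  simpa using this

theorem ne3 (h : WG m v) {a b c : ℕ} {x y z : ZMod 7} (hab : a ≠ b) (hbc : b ≠ c) (hx : x ≠ 0) (hy : y ≠ 0)
    (hz : z ≠ 0) : v (a, x) * v (b, y) * v (c, z) ≠ 1 := by
  have := h.short (W := fun k => if k = 0 then (a, x) else if k = 1 then (b, y) else (c, z))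
    (n := 3) (by omega) (by omega)
    (fun k _ => by split_ifs <;> assumption)
    (fun k hk => by
      have : k = 0 ∨ k = 1 := by omega
      rcases this with rfl | rfl
      · simpa using hab
      · simpa using hbc)
  simpa [seg] using this

theorem three (h : WG m v) {a b c : ℕ} {x y z : ZMod 7} (hab : a ≠ b) (hbc : b ≠ c) (hac : a ≠ c)
    (he : v (a, x) * v (b, y) * v (c, z) = 1) : x = 0 := by
  by_contra hx
  by_cases hy : y = 0
  · subst hy
    rw [h.zero, mul_one] at he
    by_cases hz : z = 0
    · subst hz
      rw [h.zero, mul_one] at he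
      exact h.ne1 hx he
    · exact h.ne2 hac hx hz he
  · by_cases hz : z = 0
    · subst hz
      rw [h.zero, mul_one] at he
      exact h.ne2 hab hx hy he
    · exact h.ne3 hab hbc hx hy hz he

/-- torsion elements -/
theorem tors (h : WG m v) {g : G} (hg : g ^ 7 = 1) (hg1 : g ≠ 1) : ∃ t q, g = t * v q * t⁻¹ := by
  classical
  have hex : ∃ n, ∃ t, LenLE v (t * g * t⁻¹) n := by
    obtain ⟨n, hn⟩ := h.span g
    exact ⟨n, 1, by simpa using hn⟩
  obtain ⟨t, ht⟩ := Nat.find_spec hex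
  have hmin' : ∀ n' < Nat.find hex, ∀ t, ¬ LenLE v (t * g * t⁻¹) n' :=
    fun n' hn' t h' => Nat.find_min hex hn' ⟨t, h'⟩
  set n := Nat.find hex with hn
  clear_value n
  obtain ⟨g', hg'⟩ : ∃ g', g' = t * g * t⁻¹ := ⟨_, rfl⟩
  have hgg : g = t⁻¹ * g' * t := by rw [hg']; group
  have hmin : ∀ n' < n, ∀ s, ¬ LenLE v (s * g' * s⁻¹) n' := by
    intro n' hn' s
    have := hmin' n' hn' (s * t)
    rwa [hg', show s * (t * g * t⁻¹) * s⁻¹ = s * t * g * (s * t)⁻¹ by group]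
  have hg7 : g' ^ 7 = 1 := by rw [hg', conj_pow, hg]; group
  have hg'1 : g' ≠ 1 := by rintro e; rw [e] at hgg; apply hg1; rw [hgg]; group
  rw [← hg'] at ht
  obtain ⟨W0, hW0⟩ := len_exists ht
  rcases Nat.lt_or_ge n 2 with hn2 | hn2
  · have : n = 0 ∨ n = 1 := by omega
    rcases this with rfl | rfl
    · exact absurd hW0.symm hg'1
    · rw [seg_one] at hW0
      exact ⟨t⁻¹, W0 0, by rw [hW0, hgg]; group⟩
  exfalso
  let W : ℕ → ℕ × ZMod 7 := fun k => W0 (k % n)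
  have hWp : ∀ k, W (k + n) = W k := fun k => by simp [W]
  have hW : seg (fun k => v (W k)) 0 n = g' := by
    rw [← hW0]
    apply seg_congr
    intro k hk
    simp only [W]
    rw [zero_add, Nat.mod_eq_of_lt hk]
  have rot : ∀ o, seg (fun k => v (W k)) o n =
      (seg (fun k => v (W k)) 0 o)⁻¹ * g' * (seg (fun k => v (W k)) 0 o) := by
    intro o
    have e1 := seg_add (fun k => v (W k)) 0 o n
    have e2 := seg_add (fun k => v (W k)) 0 n o
    rw [add_comm, e2, hW] at e1
    have e3 : seg (fun k => v (W k)) (0 + n) o = seg (fun k => v (W k)) 0 o := by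
      apply seg_congr
      intro k _
      rw [zero_add, zero_add, add_comm, hWp]
    rw [e3, zero_add] at e1
    rw [mul_assoc, e1]; group
  have red : ∀ o, _ := fun o => h.min_red (W := W) (o := o) (n := n) (by
    intro n' hn' hl
    rw [rot] at hl
    refine hmin n' hn' (seg (fun k => v (W k)) 0 o)⁻¹ ?_
    rwa [inv_inv])
  obtain ⟨c, ε, o, hc, hε, ho, hw⟩ := h.gl W (n * 7) (by omega)
    (fun k _ => by simpa using (red k).1 0 (by omega))
    (fun k _ => by simpa using (red k).2.1 0 (by omega))
    (by rw [seg_period _ n (fun k => by rw [hWp]), hW, hg7])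
  have hmp := h.mpos (c 0) (c 1)
  by_cases hnM : m (c 0) (c 1) + 1 ≤ n
  · refine (red o).2.2 c ε 0 hc hε (by omega) ?_
    intro k hk
    exact hw k (by omega)
  · have e1 := hw n (by omega)
    rw [hWp, ← add_zero o, hw 0 (by omega)] at e1
    have e2 : c 0 = c n := congrArg Prod.fst e1
    have hev : n % 2 = 0 := by
      by_contra hodd
      rw [hc.parity (k := n) (k' := 1) (by omega)] at e2
      exact hc.2 e2
    have e3 : seg (fun k => v (W k)) o n = (v (c 0, ε) * v (c 1, ε)) ^ (n / 2) := by
      rw [← seg_alt (fun k => v (c k, ε)) (fun k => by rw [hc.1]), show 2 * (n / 2) = n by omega]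
      apply seg_congr
      intro k hk
      rw [hw k (by omega), zero_add]
    have e4 : seg (fun k => v (W k)) o n ^ (m (c 0) (c 1)) = 1 := by
      rw [e3, ← pow_mul, mul_comm, pow_mul, h.window_rel hc hε, one_pow]
    have e5 : seg (fun k => v (W k)) o n ^ 7 = 1 := by
      rw [rot]
      have := conj_pow (i := 7) (a := (seg (fun k => v (W k)) 0 o)⁻¹) (b := g')
      rw [inv_inv] at this
      rw [this, hg7]; group
    have e6 := h.m7 _ _ e5 e4
    rw [rot] at e6
    apply hg'1
    have : g' = (seg (fun k => v (W k)) 0 o) * 1 * (seg (fun k => v (W k)) 0 o)⁻¹ := by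
      rw [← e6]; group
    rw [this]; group

theorem pair_exp (h : WG m v) {a b : ℕ} {k l : ZMod 7} (hab : a ≠ b) (hk : k ≠ 0) (hl : l ≠ 0) {q : ℕ}
    (hq : 0 < q) (he : (v (a, k) * v (b, l)) ^ q = 1) : k = l ∧ (k = 1 ∨ k = -1) := by
  let W : ℕ → ℕ × ZMod 7 := fun i => if i % 2 = 0 then (a, k) else (b, l)
  obtain ⟨c, ε, o, hc, hε, ho, hw⟩ := h.gl W (2 * q) (by omega)
    (fun i _ => by simp only [W]; split_ifs <;> assumption)
    (fun i _ => by
      simp only [W]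
      rcases Nat.mod_two_eq_zero_or_one i with e | e
      · rw [if_pos e, if_neg (by omega)]; exact hab
      · rw [if_neg (by omega), if_pos (by omega)]; exact hab.symm)
    (by
      rw [seg_alt _ (fun i => by simp [W])]
      simpa [W] using he)
  have hmp := h.mpos (c 0) (c 1)
  have e0 := hw 0 (by omega)
  have e1 := hw 1 (by omega)
  simp only [W, add_zero] at e0 e1
  rcases Nat.mod_two_eq_zero_or_one o with e | e
  · rw [if_pos e] at e0
    rw [if_neg (by omega)] at e1
    have a0 : k = ε := congrArg Prod.snd e0
    have a1 : l = ε := congrArg Prod.snd e1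
    rw [a0, a1]; exact ⟨rfl, hε⟩
  · rw [if_neg (by omega)] at e0
    rw [if_pos (by omega)] at e1
    have a0 : l = ε := congrArg Prod.snd e0
    have a1 : k = ε := congrArg Prod.snd e1
    rw [a0, a1]; exact ⟨rfl, hε⟩

end WG
end GW

namespace GW
namespace WG
variable {G : Type} [Group G] {m : ℕ → ℕ → ℕ} {v : ℕ × ZMod 7 → G}

theorem blk {D q r : ℕ} (hr : r < D) : (q * D + r) / D = q ∧ (q * D + r) % D = r := by
  have hD : 0 < D := by omega
  refine ⟨?_, ?_⟩
  · rw [mul_comm, Nat.mul_add_div hD, Nat.div_eq_of_lt hr, add_zero]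
  · rw [mul_comm, Nat.mul_add_mod, Nat.mod_eq_of_lt hr]

theorem double_coset (h : WG m v) {a b : ℕ} {x y : ZMod 7} (hx : x ≠ 0) (hy : y ≠ 0) {s : G} {N : ℕ}
    (hN : 0 < N) (he : (v (a, x) * (s * v (b, y) * s⁻¹)) ^ N = 1) :
    ∃ p r, s = v (a, p) * v (b, r) := by
  classical
  have hex : ∃ n, ∃ p r, LenLE v (v (a, p) * s * v (b, r)) n := by
    obtain ⟨n, hn⟩ := h.span s
    exact ⟨n, 0, 0, by simpa [h.zero] using hn⟩
  obtain ⟨p0, r0, ht⟩ := Nat.find_spec hex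
  have hmin' : ∀ n' < Nat.find hex, ∀ p r, ¬ LenLE v (v (a, p) * s * v (b, r)) n' :=
    fun n' hn' p r h' => Nat.find_min hex hn' ⟨p, r, h'⟩
  set d := Nat.find hex with hd
  clear_value d
  obtain ⟨s0, hs0⟩ : ∃ s0, s0 = v (a, p0) * s * v (b, r0) := ⟨_, rfl⟩
  rw [← hs0] at ht
  have hss : s = v (a, -p0) * s0 * v (b, -r0) := by
    rw [hs0, h.neg, h.neg]; group
  have hmin : ∀ n' < d, ∀ p r, ¬ LenLE v (v (a, p) * s0 * v (b, r)) n' := by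
    intro n' hn' p r
    have := hmin' n' hn' (p + p0) (r0 + r)
    rwa [hs0, show v (a, p) * (v (a, p0) * s * v (b, r0)) * v (b, r) =
      v (a, p + p0) * s * v (b, r0 + r) by rw [h.add, h.add]; group]
  rcases Nat.eq_zero_or_pos d with hd0 | hd0
  · subst hd0
    obtain ⟨W, hW⟩ := len_exists ht
    have hW' : (1 : G) = s0 := hW
    exact ⟨-p0, -r0, by rw [hss, ← hW', mul_one]⟩
  exfalso
  -- transfer of the torsion relation
  have he0 : (v (a, x) * s0 * (v (b, y) * s0⁻¹)) ^ N = 1 := by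
    have e1 : v (a, x) * (s * v (b, y) * s⁻¹) =
        v (a, -p0) * (v (a, x) * s0 * (v (b, y) * s0⁻¹)) * (v (a, -p0))⁻¹ := by
      rw [hss]
      have c1 := h.comm a x (-p0)
      have c2 := h.comm b (-r0) y
      calc v (a, x) * (v (a, -p0) * s0 * v (b, -r0) * v (b, y) *
            (v (a, -p0) * s0 * v (b, -r0))⁻¹)
          = (v (a, x) * v (a, -p0)) * s0 * (v (b, -r0) * v (b, y)) *
            (v (a, -p0) * s0 * v (b, -r0))⁻¹ := by group
        _ = _ := by rw [c1, c2]; group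
    rw [e1, conj_pow] at he
    have : (v (a, x) * s0 * (v (b, y) * s0⁻¹)) ^ N = (v (a, -p0))⁻¹ * 1 * v (a, -p0) := by
      rw [← he]; group
    rw [this]; group
  obtain ⟨W, hW⟩ := len_exists ht
  obtain ⟨r1, r2, r3⟩ := h.min_red (W := W) (o := 0) (n := d) (by
    intro n' hn' hl
    rw [hW] at hl
    exact hmin n' hn' 0 0 (by simpa [h.zero] using hl))
  simp only [zero_add] at r1 r2 r3
  have hfirst : (W 0).1 ≠ a := by
    intro h0
    apply hmin (d - 1) (by omega) (-(W 0).2) 0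
    rw [h.zero, mul_one, ← hW, show d = 1 + (d - 1) by omega, seg_add, seg_one, ← mul_assoc,
      show v (a, -(W 0).2) * v (W 0) = 1 by
        rw [← h0, h.neg]; simp, one_mul]
    simpa using len_seg (v := v) W 1 (d - 1)
  have hlast : (W (d - 1)).1 ≠ b := by
    intro h0
    apply hmin (d - 1) (by omega) 0 (-(W (d - 1)).2)
    have e : s0 = seg (fun k => v (W k)) 0 (d - 1) * v (W (d - 1)) := by
      rw [← hW]
      conv_lhs => rw [show d = d - 1 + 1 by omega]
      simp only [seg, zero_add]
    rw [h.zero, one_mul, e, mul_assoc,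
      show v (W (d - 1)) * v (b, -(W (d - 1)).2) = 1 by
        rw [← h0, h.neg]; simp, mul_one]
    exact len_seg (v := v) W 0 (d - 1)
  -- the periodic word
  obtain ⟨D, hD⟩ : ∃ D, D = d + 1 := ⟨_, rfl⟩
  let Z : ℕ → ℕ × ZMod 7 := fun k =>
    if k % D = 0 then (if (k / D) % 2 = 0 then (a, x) else (b, y))
    else if (k / D) % 2 = 0 then W (k % D - 1) else ((W (d - k % D)).1, -(W (d - k % D)).2)
  have Z0e : ∀ q, q % 2 = 0 → Z (q * D) = (a, x) := by
    intro q hq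
    obtain ⟨e1, e2⟩ := blk (D := D) (q := q) (r := 0) (by omega)
    rw [add_zero] at e1 e2
    simp only [Z]
    rw [e1, e2, if_pos rfl, if_pos hq]
  have Z0o : ∀ q, q % 2 = 1 → Z (q * D) = (b, y) := by
    intro q hq
    obtain ⟨e1, e2⟩ := blk (D := D) (q := q) (r := 0) (by omega)
    rw [add_zero] at e1 e2
    simp only [Z]
    rw [e1, e2, if_pos rfl, if_neg (by omega)]
  have Ze : ∀ q r, q % 2 = 0 → 0 < r → r < D → Z (q * D + r) = W (r - 1) := by
    intro q r hq h0 hr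
    obtain ⟨e1, e2⟩ := blk (D := D) (q := q) (r := r) hr
    simp only [Z]
    rw [e1, e2, if_neg (by omega), if_pos hq]
  have Zo : ∀ q r, q % 2 = 1 → 0 < r → r < D →
      Z (q * D + r) = ((W (d - r)).1, -(W (d - r)).2) := by
    intro q r hq h0 hr
    obtain ⟨e1, e2⟩ := blk (D := D) (q := q) (r := r) hr
    simp only [Z]
    rw [e1, e2, if_neg (by omega), if_neg (by omega)]
  have dec : ∀ k, ∃ q r, r < D ∧ k = q * D + r := fun k =>
    ⟨k / D, k % D, Nat.mod_lt _ (by omega), by rw [mul_comm]; exact (Nat.div_add_mod k D).symm⟩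
  have Zred0 : ∀ k, (Z k).2 ≠ 0 := by
    intro k
    obtain ⟨q, r, hr, rfl⟩ := dec k
    rcases Nat.eq_zero_or_pos r with h0 | h0
    · subst h0
      rw [add_zero]
      rcases Nat.mod_two_eq_zero_or_one q with hq | hq
      · rw [Z0e q hq]; exact hx
      · rw [Z0o q hq]; exact hy
    · rcases Nat.mod_two_eq_zero_or_one q with hq | hq
      · rw [Ze q r hq h0 hr]; exact r1 _ (by omega)
      · rw [Zo q r hq h0 hr]; exact neg_ne_zero.2 (r1 _ (by omega))
  have Zred1 : ∀ k, (Z k).1 ≠ (Z (k + 1)).1 := by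
    intro k
    obtain ⟨q, r, hr, rfl⟩ := dec k
    rcases Nat.eq_zero_or_pos r with h0 | h0
    · subst h0
      rw [add_zero]
      rcases Nat.mod_two_eq_zero_or_one q with hq | hq
      · rw [Z0e q hq, Ze q 1 hq (by omega) (by omega)]; exact hfirst.symm
      · rw [Z0o q hq, Zo q 1 hq (by omega) (by omega)]; exact hlast.symm
    · by_cases hr1 : r = d
      · rw [show q * D + r + 1 = (q + 1) * D by rw [hr1, hD]; ring]
        rcases Nat.mod_two_eq_zero_or_one q with hq | hq
        · rw [Ze q r hq h0 hr, Z0o (q + 1) (by omega), hr1]; exact hlast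
        · rw [Zo q r hq h0 hr, Z0e (q + 1) (by omega), hr1, Nat.sub_self]; exact hfirst
      · rw [add_assoc]
        rcases Nat.mod_two_eq_zero_or_one q with hq | hq
        · rw [Ze q r hq h0 hr, Ze q (r + 1) hq (by omega) (by omega)]
          have := r2 (r - 1) (by omega)
          rwa [show r - 1 + 1 = r + 1 - 1 by omega] at this
        · rw [Zo q r hq h0 hr, Zo q (r + 1) hq (by omega) (by omega)]
          have := r2 (d - (r + 1)) (by omega)
          rw [show d - (r + 1) + 1 = d - r by omega] at this
          exact this.symm
  have Zper : ∀ k, Z (k + 2 * D) = Z k := by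
    intro k
    obtain ⟨q, r, hr, rfl⟩ := dec k
    rw [show q * D + r + 2 * D = (q + 2) * D + r by ring]
    rcases Nat.eq_zero_or_pos r with h0 | h0
    · subst h0
      rw [add_zero, add_zero]
      rcases Nat.mod_two_eq_zero_or_one q with hq | hq
      · rw [Z0e q hq, Z0e _ (by omega)]
      · rw [Z0o q hq, Z0o _ (by omega)]
    · rcases Nat.mod_two_eq_zero_or_one q with hq | hq
      · rw [Ze q r hq h0 hr, Ze _ r (by omega) h0 hr]
      · rw [Zo q r hq h0 hr, Zo _ r (by omega) h0 hr]
  have Zseg : seg (fun k => v (Z k)) 0 (2 * D) = v (a, x) * s0 * (v (b, y) * s0⁻¹) := by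
    rw [show 2 * D = (1 + d) + (1 + d) by omega, seg_add, seg_add, seg_add, seg_one, seg_one]
    have b1 : Z 0 = (a, x) := by simpa using Z0e 0 rfl
    have b2 : Z (0 + (1 + d)) = (b, y) := by
      rw [← Z0o 1 rfl]; congr 1; omega
    rw [b1, b2]
    congr 2
    · rw [← hW]
      apply seg_congr
      intro k hk
      have := Ze 0 (1 + k) rfl (by omega) (by omega)
      rw [zero_mul, zero_add] at this
      rw [zero_add, zero_add, this]; congr 2; omega
    · rw [← hW, ← seg_inv]
      apply seg_congr
      intro k hk
      have := Zo 1 (1 + k) rfl (by omega) (by omega)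
      rw [show 0 + (1 + d) + 1 + k = 1 * D + (1 + k) by omega, this, h.neg]
      rw [show d - 1 - (0 + k) = d - (1 + k) by omega]
  obtain ⟨c, ε, o, hc, hε, ho, hw⟩ := h.gl Z (2 * D * N) (Nat.mul_pos (by omega) hN)
    (fun k _ => Zred0 k) (fun k _ => Zred1 k)
    (by rw [seg_period _ (2 * D) (fun k => by rw [Zper]), Zseg, he0])
  have hmp := h.mpos (c 0) (c 1)
  set M := m (c 0) (c 1) with hM
  have hεn : ε ≠ -ε := by rcases hε with rfl | rfl <;> decide
  -- no interior multiple of D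
  have nomult : ∀ q, o + 1 ≤ q * D → q * D + 1 < o + (2 * M - 4) → False := by
    intro q h1 h2
    have w1 := hw (q * D + 1 - o) (by omega)
    have w2 := hw (q * D - 1 - o) (by omega)
    rw [show o + (q * D + 1 - o) = q * D + 1 by omega] at w1
    have hq0 : 0 < q := by
      rcases Nat.eq_zero_or_pos q with e | e
      · subst e; omega
      · exact e
    obtain ⟨q', rfl⟩ : ∃ q', q = q' + 1 := ⟨q - 1, by omega⟩
    have e3 : o + ((q' + 1) * D - 1 - o) = q' * D + d := by
      have : (q' + 1) * D = q' * D + D := by ring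
      omega
    rw [e3] at w2
    have w1' := congrArg Prod.snd w1
    have w2' := congrArg Prod.snd w2
    rcases Nat.mod_two_eq_zero_or_one q' with hq | hq
    · rw [Ze q' d hq hd0 (by omega)] at w2'
      rw [Zo _ 1 (by omega) (by omega) (by omega)] at w1'
      simp only at w1' w2'
      rw [w2'] at w1'
      exact hεn w1'.symm
    · rw [Zo q' d hq hd0 (by omega)] at w2'
      rw [Ze _ 1 (by omega) (by omega) (by omega)] at w1'
      simp only [Nat.sub_self] at w1' w2'
      rw [w1'] at w2'
      exact hεn w2'.symm
  obtain ⟨q, r, hr, hor⟩ := dec (o + 1)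
  have hr0 : 0 < r := by
    rcases Nat.eq_zero_or_pos r with e | e
    · exact (nomult q (by omega) (by omega)).elim
    · exact e
  have hrD : r + (2 * M - 6) ≤ D := by
    by_contra hcon
    have : (q + 1) * D = q * D + D := by ring
    exact nomult (q + 1) (by omega) (by omega)
  rcases Nat.mod_two_eq_zero_or_one q with hq | hq
  · have hc' := hc.sh 1
    have hm' : m (sh 1 c 0) (sh 1 c 1) = M := mm_sh h.sym hc 1
    refine r3 (sh 1 c) ε (r - 1) hc' hε (by rw [hm']; omega) ?_
    intro k hk
    rw [hm'] at hk
    have := Ze q (r + k) hq (by omega) (by omega)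
    rw [show r - 1 + k = r + k - 1 by omega, ← this, ← add_assoc, ← hor, add_assoc,
      hw (1 + k) (by omega)]
    simp only [sh]; rw [add_comm]
  · have hc' := hc.sh (M + 1)
    have hm' : m (sh (M + 1) c 0) (sh (M + 1) c 1) = M := mm_sh h.sym hc _
    refine r3 (sh (M + 1) c) (-ε) (d - r - M) hc' ?_ (by rw [hm']; omega) ?_
    · rcases hε with rfl | rfl
      · right; rfl
      · left; simp
    intro k hk
    rw [hm'] at hk
    have := Zo q (r + (M - k)) hq (by omega) (by omega)
    rw [← add_assoc, ← hor, add_assoc, hw (1 + (M - k)) (by omega)] at this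
    rw [show d - r - M + k = d - (r + (M - k)) by omega]
    have t1 := congrArg Prod.fst this
    have t2 := congrArg Prod.snd this
    simp only at t1 t2
    ext1
    · rw [← t1]; simp only [sh]; exact hc.parity (by omega)
    · simp only; rw [t2, neg_neg]

end WG
end GW

namespace GW
namespace WG

theorem conj_same {G : Type} [Group G] {m : ℕ → ℕ → ℕ} {v : ℕ × ZMod 7 → G} (h : WG m v)
    (t : G) (a : ℕ) (p k : ZMod 7) :
    (t * v (a, p)) * v (a, k) * (t * v (a, p))⁻¹ = t * v (a, k) * t⁻¹ := by
  rw [mul_assoc t, h.comm]; group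

/-- The abstract rigidity statement. -/
theorem rigid {G G' : Type} [Group G] [Group G'] {m m' : ℕ → ℕ → ℕ}
    {v : ℕ × ZMod 7 → G} {v' : ℕ × ZMod 7 → G'} (h : WG m v) (h' : WG m' v') (θ : G ≃* G') :
    ∃ ρ : ℕ ≃ ℕ, (∀ i j, i ≠ j → m i j = m' (ρ i) (ρ j)) ∧ ∃ (t : G') (ε : ZMod 7),
      (ε = 1 ∨ ε = -1) ∧ ∀ i, θ (v (i, 1)) = t * v' (ρ i, ε) * t⁻¹ := by
  have h1 : (1 : ZMod 7) ≠ 0 := by decide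
  have hex : ∀ i, ∃ t q, θ (v (i, 1)) = t * v' q * t⁻¹ := fun i => h'.tors
    (by rw [← map_pow, h.pow7, map_one])
    (fun e => h.ne1 (a := i) h1 (θ.injective (by rw [e, map_one])))
  choose t q ht using hex
  obtain ⟨r, hr⟩ : ∃ r : ℕ → ℕ, ∀ i, (q i).1 = r i := ⟨_, fun _ => rfl⟩
  obtain ⟨k, hk⟩ : ∃ k : ℕ → ZMod 7, ∀ i, (q i).2 = k i := ⟨_, fun _ => rfl⟩
  have hq : ∀ i, q i = (r i, k i) := fun i => by rw [← hr, ← hk]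
  simp only [hq] at ht
  have k0 : ∀ i, k i ≠ 0 := by
    intro i e
    have := ht i
    rw [e, h'.zero, mul_one, mul_inv_cancel] at this
    exact h.ne1 (a := i) h1 (θ.injective (by rw [this, map_one]))
  have pair : ∀ i j, i ≠ j → ∃ p s, t i * v' (r i, p) = t j * v' (r j, s) := by
    intro i j hij
    have e : (v' (r i, k i) * (((t i)⁻¹ * t j) * v' (r j, k j) * ((t i)⁻¹ * t j)⁻¹)) ^ (m i j)
        = 1 := by
      have : v' (r i, k i) * (((t i)⁻¹ * t j) * v' (r j, k j) * ((t i)⁻¹ * t j)⁻¹)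
          = (t i)⁻¹ * (θ (v (i, 1)) * θ (v (j, 1))) * (t i)⁻¹⁻¹ := by
        rw [ht, ht]; group
      rw [this, conj_pow, ← map_mul, ← map_pow, h.rel i j hij]
      simp
    obtain ⟨p, s, hs⟩ := h'.double_coset (k0 i) (k0 j) (by have := h.mpos i j; omega) e
    refine ⟨p, -s, ?_⟩
    rw [h'.neg]
    have : t j = t i * (v' (r i, p) * v' (r j, s)) := by rw [← hs]; group
    rw [this]; group
  have key : ∀ i j, i ≠ j → ∃ τ p s, τ = t i * v' (r i, p) ∧ τ = t j * v' (r j, s) ∧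
      θ (v (i, 1) * v (j, 1)) = τ * (v' (r i, k i) * v' (r j, k j)) * τ⁻¹ := by
    intro i j hij
    obtain ⟨p, s, e⟩ := pair i j hij
    refine ⟨t i * v' (r i, p), p, s, rfl, e, ?_⟩
    rw [map_mul, ht, ht, ← h'.conj_same (t i) (r i) p, ← h'.conj_same (t j) (r j) s, ← e]
    group
  have powr : ∀ i j, i ≠ j → (v' (r i, k i) * v' (r j, k j)) ^ (m i j) = 1 := by
    intro i j hij
    obtain ⟨τ, p, s, -, -, e⟩ := key i j hij
    have : v' (r i, k i) * v' (r j, k j) = τ⁻¹ * θ (v (i, 1) * v (j, 1)) * τ⁻¹⁻¹ := by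
      rw [e]; group
    rw [this, conj_pow, ← map_pow, h.rel i j hij]
    simp
  have prod1 : ∀ i j, i ≠ j → v' (r i, k i) * v' (r j, k j) ≠ 1 := by
    intro i j hij e1
    obtain ⟨τ, p, s, -, -, e⟩ := key i j hij
    rw [e1] at e
    exact h.ne2 hij h1 h1 (θ.injective (by rw [e]; simp))
  have rinj : ∀ i j, i ≠ j → r i ≠ r j := by
    intro i j hij e
    have e7 : (v' (r i, k i) * v' (r j, k j)) ^ 7 = 1 := by rw [e, ← h'.add, h'.pow7]
    have h3 := Nat.dvd_gcd (orderOf_dvd_of_pow_eq_one e7)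
      (orderOf_dvd_of_pow_eq_one (powr i j hij))
    apply prod1 i j hij
    rw [← orderOf_eq_one_iff, ← Nat.dvd_one]
    rcases h.hm i j with a | a <;> rw [a] at h3 <;> simpa using h3
  have kk : ∀ i j, i ≠ j → k i = k j ∧ (k i = 1 ∨ k i = -1) := fun i j hij =>
    h'.pair_exp (rinj i j hij) (k0 i) (k0 j) (by have := h.mpos i j; omega) (powr i j hij)
  have km : ∀ i j, i ≠ j → m i j = m' (r i) (r j) := by
    intro i j hij
    have e1 := powr i j hij
    have e2 : (v' (r i, k i) * v' (r j, k j)) ^ (m' (r i) (r j)) = 1 := by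
      obtain ⟨ekk, hk⟩ := kk i j hij
      rw [← ekk]
      rcases hk with e | e
      · rw [e]; exact h'.rel _ _ (rinj i j hij)
      · rw [e, h'.neg, h'.neg, ← mul_inv_rev, inv_pow, h'.sym, h'.rel _ _ (rinj i j hij).symm,
          inv_one]
    by_contra hne
    have h1 := orderOf_dvd_of_pow_eq_one e1
    have h2 := orderOf_dvd_of_pow_eq_one e2
    have h3 := Nat.dvd_gcd h1 h2
    apply prod1 i j hij
    rw [← orderOf_eq_one_iff, ← Nat.dvd_one]
    rcases h.hm i j with a | a <;> rcases h'.hm (r i) (r j) with b | b <;> rw [a, b] at h3 hne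
    · exact absurd rfl hne
    · simpa using h3
    · simpa using h3
    · exact absurd rfl hne
  have surj : ∀ d, ∃ e, r e = d := by
    intro d
    obtain ⟨u, ⟨e, x⟩, hu⟩ := h.tors (g := θ.symm (v' (d, 1)))
      (by rw [← map_pow, h'.pow7, map_one])
      (fun e => h'.ne1 (a := d) h1 (θ.symm.injective (by rw [e, map_one])))
    refine ⟨e, ?_⟩
    have e1 : v (e, x) = v (e, 1) ^ x.val := by
      rw [h.pow, mul_one, ZMod.natCast_zmod_val]
    have e2 : v' (d, 1) = (θ u * t e) * v' (r e, x.val * k e) * (θ u * t e)⁻¹ := by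
      rw [← h'.pow, ← θ.apply_symm_apply (v' (d, 1)), hu, e1, map_mul, map_mul, map_pow, ht,
        conj_pow, map_inv]
      group
    set s := θ u * t e
    set y := (x.val : ZMod 7) * k e
    have hy : y ≠ 0 := by
      intro e
      rw [e, h'.zero] at e2
      exact h'.ne1 h1 (by rw [e2]; simp)
    by_contra hne
    obtain ⟨p, w, hs⟩ := h'.double_coset (a := d) (x := -1) (b := r e) (y := y) (s := s) (N := 1)
      (by decide) hy one_pos (by rw [← e2, ← h'.add]; simp [h'.zero])
    rw [hs, h'.conj_same] at e2
    have e3 : v' (d, 1) = v' (r e, y) := by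
      have : v' (r e, y) = (v' (d, p))⁻¹ * v' (d, 1) * v' (d, p) := by rw [e2]; group
      rw [this, mul_assoc, h'.comm d 1 p]; group
    refine h'.ne2 (a := d) (b := r e) (x := 1) (y := -y) (fun e => hne e.symm) h1
      (neg_ne_zero.mpr hy) ?_
    rw [h'.neg, e3]; group
  have rI : Function.Injective r := fun i j e => by
    by_contra hij; exact rinj i j hij e
  obtain ⟨τ, p0, p1, hτ0, hτ1, -⟩ := key 0 1 (by decide)
  refine ⟨Equiv.ofBijective r ⟨rI, surj⟩, fun i j hij => km i j hij, τ, k 0,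
    (kk 0 1 (by decide)).2, fun i => ?_⟩
  change θ (v (i, 1)) = τ * v' (r i, k 0) * τ⁻¹
  have ki : k i = k 0 := by
    by_cases hi : i = 0
    · rw [hi]
    · exact (kk i 0 hi).1
  rw [← ki]
  suffices hs : ∃ s, τ = t i * v' (r i, s) by
    obtain ⟨s, hs⟩ := hs
    rw [hs, h'.conj_same]; exact ht i
  by_cases hi0 : i = 0
  · subst hi0; exact ⟨_, hτ0⟩
  by_cases hi1 : i = 1
  · subst hi1; exact ⟨_, hτ1⟩
  obtain ⟨a, b, e0⟩ := pair 0 i (Ne.symm hi0)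
  obtain ⟨c, d, e1⟩ := pair 1 i (Ne.symm hi1)
  have E0 : τ * v' (r 0, a - p0) = t i * v' (r i, b) := by
    rw [← e0, hτ0, mul_assoc, ← h'.add]; congr 3; ring
  have E1 : τ * v' (r 1, c - p1) = t i * v' (r i, d) := by
    rw [← e1, hτ1, mul_assoc, ← h'.add]; congr 3; ring
  have E2 : v' (r 0, a - p0) * v' (r i, d - b) * v' (r 1, -(c - p1)) = 1 := by
    have x0 : v' (r 0, a - p0) = τ⁻¹ * (t i * v' (r i, b)) := by rw [← E0]; group
    have x1 : v' (r 1, c - p1) = τ⁻¹ * (t i * v' (r i, d)) := by rw [← E1]; group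
    have x2 : v' (r i, d) = v' (r i, b) * v' (r i, d - b) := by rw [← h'.add]; congr 2; ring
    rw [h'.neg, x0, x1, x2]; group
  have z := h'.three (rinj 0 i (Ne.symm hi0)) (rinj i 1 hi1) (rinj 0 1 (by decide)) E2
  rw [z, h'.zero, mul_one] at E0
  exact ⟨_, E0⟩
end WG

theorem gen_pow7 (T : SimpleGraph ℕ) (i : ℕ) : gen T.Adj i ^ 7 = 1 := by
  have : PresentedGroup.mk (grRels T.Adj) (FreeGroup.of i ^ 7) = 1 :=
    PresentedGroup.one_of_mem (Or.inl ⟨i, rfl⟩)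
  rw [map_pow] at this
  exact this

theorem gen_rel (T : SimpleGraph ℕ) (i j : ℕ) (hij : i ≠ j) :
    (gen T.Adj i * gen T.Adj j) ^ mT T i j = 1 := by
  have : PresentedGroup.mk (grRels T.Adj) ((FreeGroup.of i * FreeGroup.of j) ^ mT T i j) = 1 := by
    apply PresentedGroup.one_of_mem
    by_cases h : T.Adj i j
    · exact Or.inr (Or.inl ⟨i, j, h, by simp [mT, h]⟩)
    · exact Or.inr (Or.inr ⟨i, j, hij, h, by simp [mT, h]⟩)
  rw [map_pow, map_mul] at this
  exact this

theorem vv_one (T : SimpleGraph ℕ) (i : ℕ) : vv T (i, 1) = gen T.Adj i := by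
  have : (1 : ZMod 7).val = 1 := by decide
  simp [vv, this]

theorem vv_cast (T : SimpleGraph ℕ) (i n : ℕ) : vv T (i, (n : ZMod 7)) = gen T.Adj i ^ n := by
  simp only [vv, ZMod.val_natCast]
  exact (pow_eq_pow_mod n (gen_pow7 T i)).symm

theorem vv_add (T : SimpleGraph ℕ) (i : ℕ) (a b : ZMod 7) :
    vv T (i, a + b) = vv T (i, a) * vv T (i, b) := by
  rw [← ZMod.natCast_zmod_val a, ← ZMod.natCast_zmod_val b, ← Nat.cast_add, vv_cast, vv_cast,
    vv_cast, pow_add]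

theorem vv_neg_one (T : SimpleGraph ℕ) (i : ℕ) : vv T (i, -1) = (gen T.Adj i)⁻¹ := by
  rw [eq_inv_iff_mul_eq_one, ← vv_one, ← vv_add, neg_add_cancel]
  simp [vv]

theorem wg (T : SimpleGraph ℕ) : WG (mT T) (vv T) where
  sym := mT_sym T
  hm i j := by unfold mT; split_ifs <;> simp
  add := vv_add T
  rel i j hij := by rw [vv_one, vv_one, gen_rel T i j hij]
  gl := glThm T
  span g := by
    induction g using PresentedGroup.induction_on with
    | _ z =>
    induction z using FreeGroup.induction_on with
    | C1 => exact ⟨0, by rw [map_one]; exact LenLE.nil⟩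
    | of i => exact ⟨1, by
        have := WG.len_one (v := vv T) (i, 1)
        rw [vv_one] at this; exact this⟩
    | inv_of i _ => exact ⟨1, by
        have := WG.len_one (v := vv T) (i, -1)
        rw [vv_neg_one] at this; rw [map_inv]; exact this⟩
    | mul x y hx hy =>
      obtain ⟨n, hn⟩ := hx
      obtain ⟨k, hk⟩ := hy
      exact ⟨n + k, by rw [map_mul]; exact WG.len_mul hn hk⟩

theorem rel_zpow (S : SimpleGraph ℕ) (ε : ℤ) (hε : ε = 1 ∨ ε = -1) (i j : ℕ) (hij : i ≠ j) :
    (gen S.Adj i ^ ε * gen S.Adj j ^ ε) ^ mT S i j = 1 := by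
  rcases hε with rfl | rfl
  · simpa using gen_rel S i j hij
  · rw [zpow_neg_one, zpow_neg_one, ← mul_inv_rev, inv_pow, mT_sym, gen_rel S j i hij.symm, inv_one]

/-- the homomorphism induced by a graph isomorphism -/
theorem exists_hom (T S : SimpleGraph ℕ) (ρ : ℕ ≃ ℕ)
    (hρ : ∀ m n, T.Adj m n ↔ S.Adj (ρ m) (ρ n)) (ε : ℤ) (hε : ε = 1 ∨ ε = -1) :
    ∃ f : GT T.Adj →* GT S.Adj, ∀ i, f (gen T.Adj i) = gen S.Adj (ρ i) ^ ε := by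
  have hr : ∀ r ∈ grRels T.Adj, FreeGroup.lift (fun i => gen S.Adj (ρ i) ^ ε) r = 1 := by
    rintro r (⟨i, rfl⟩ | ⟨i, j, hij, rfl⟩ | ⟨i, j, hne, hij, rfl⟩)
    · rw [map_pow, FreeGroup.lift_apply_of, ← zpow_natCast, ← zpow_mul, mul_comm, zpow_mul,
        zpow_natCast, gen_pow7, one_zpow]
    · have := rel_zpow S ε hε (ρ i) (ρ j) (fun e => hij.ne (ρ.injective e))
      rw [map_pow, map_mul, FreeGroup.lift_apply_of, FreeGroup.lift_apply_of, ← this]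
      simp [mT, (hρ i j).mp hij]
    · have := rel_zpow S ε hε (ρ i) (ρ j) (fun e => hne (ρ.injective e))
      rw [map_pow, map_mul, FreeGroup.lift_apply_of, FreeGroup.lift_apply_of, ← this]
      simp [mT, mt (hρ i j).mpr hij]
  exact ⟨PresentedGroup.toGroup hr, fun i => PresentedGroup.toGroup.of hr⟩

theorem part_a (T S : SimpleGraph ℕ) (ρ : ℕ ≃ ℕ)
    (hρ : ∀ m n, T.Adj m n ↔ S.Adj (ρ m) (ρ n)) (t : GT S.Adj) (ε : ℤ) (hε : ε = 1 ∨ ε = -1) :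
    ∃ θ : GT T.Adj ≃* GT S.Adj, ∀ i, θ (gen T.Adj i) = t * gen S.Adj (ρ i) ^ ε * t⁻¹ := by
  obtain ⟨f, hf⟩ := exists_hom T S ρ hρ ε hε
  obtain ⟨g, hg⟩ := exists_hom S T ρ.symm (fun m n => by rw [hρ]; simp) ε hε
  have ee : ε * ε = 1 := by rcases hε with rfl | rfl <;> rfl
  have gf : g.comp f = MonoidHom.id _ := by
    apply PresentedGroup.ext
    intro i
    change g (f (gen T.Adj i)) = gen T.Adj i
    rw [hf, map_zpow, hg, ← zpow_mul, ee]; simp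
  have fg : f.comp g = MonoidHom.id _ := by
    apply PresentedGroup.ext
    intro i
    change f (g (gen S.Adj i)) = gen S.Adj i
    rw [hg, map_zpow, hf, ← zpow_mul, ee]; simp
  refine ⟨(MonoidHom.toMulEquiv f g gf fg).trans (MulAut.conj t), fun i => ?_⟩
  change t * f (gen T.Adj i) * t⁻¹ = _
  rw [hf]

theorem part_b (T S : SimpleGraph ℕ) (θ : GT T.Adj ≃* GT S.Adj) :
    ∃ ρ : ℕ ≃ ℕ, (∀ m n, T.Adj m n ↔ S.Adj (ρ m) (ρ n)) ∧
      ∃ (t : GT S.Adj) (ε : ℤ), (ε = 1 ∨ ε = -1) ∧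
        ∀ i, θ (gen T.Adj i) = t * gen S.Adj (ρ i) ^ ε * t⁻¹ := by
  obtain ⟨ρ, hρ, t, ε, hε, h⟩ := (wg T).rigid (wg S) θ
  refine ⟨ρ, fun i j => ?_, t, ?_⟩
  · by_cases hij : i = j
    · subst hij; simp
    · have := hρ i j hij
      unfold mT at this
      by_cases a : T.Adj i j <;> by_cases b : S.Adj (ρ i) (ρ j) <;> simp_all
  · simp only [vv_one] at h
    rcases hε with rfl | rfl
    · exact ⟨1, Or.inl rfl, fun i => by rw [h, vv_one, zpow_one]⟩
    · exact ⟨-1, Or.inr rfl, fun i => by rw [h, vv_neg_one, zpow_neg_one]⟩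

end GW

/-- **Remark 3.6.** (a) Every graph isomorphism `ρ : T → S`, together with `t ∈ G_S` and
`ε ∈ {-1, 1}`, induces a group isomorphism `G_T → G_S` sending `v_i` to
`t v_{ρ(i)}^ε t⁻¹`; (b) conversely, every group isomorphism `G_T → G_S` is of this form.
In particular, `T ≅ S` iff `G_T ≅ G_S`. -/
theorem iso_GT_GS_characterization (T S : SimpleGraph ℕ) :
    (∀ ρ : ℕ ≃ ℕ, (∀ m n, T.Adj m n ↔ S.Adj (ρ m) (ρ n)) →
      ∀ (t : GT S.Adj) (ε : ℤ), (ε = 1 ∨ ε = -1) →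
        ∃ θ : GT T.Adj ≃* GT S.Adj, ∀ i, θ (gen T.Adj i) = t * gen S.Adj (ρ i) ^ ε * t⁻¹) ∧
    (∀ θ : GT T.Adj ≃* GT S.Adj,
      ∃ ρ : ℕ ≃ ℕ, (∀ m n, T.Adj m n ↔ S.Adj (ρ m) (ρ n)) ∧
        ∃ (t : GT S.Adj) (ε : ℤ), (ε = 1 ∨ ε = -1) ∧
          ∀ i, θ (gen T.Adj i) = t * gen S.Adj (ρ i) ^ ε * t⁻¹) ∧
    ((∃ ρ : ℕ ≃ ℕ, ∀ m n, T.Adj m n ↔ S.Adj (ρ m) (ρ n)) ↔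
      Nonempty (GT T.Adj ≃* GT S.Adj)) := by
  refine ⟨fun ρ hρ t ε hε => GW.part_a T S ρ hρ t ε hε, fun θ => GW.part_b T S θ, ?_, ?_⟩
  · rintro ⟨ρ, hρ⟩
    obtain ⟨θ, -⟩ := GW.part_a T S ρ hρ 1 1 (Or.inl rfl)
    exact ⟨θ⟩
  · rintro ⟨θ⟩
    obtain ⟨ρ, hρ, -⟩ := GW.part_b T S θ
    exact ⟨ρ, hρ⟩
end

section
/- For every simple graph T on vertex set ℕ, the set R_T is symmetrized and satisfies the small cancellation condition C'(1/6). -/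
/-- A reduced word (i.e. an element of a free group) is cyclically reduced if its first
letter is not the inverse of its last letter. -/
def CyclicallyReduced {V : Type*} [DecidableEq V] (w : FreeGroup V) : Prop :=
  ∀ a ∈ w.toWord.head?, ∀ b ∈ w.toWord.getLast?, a ≠ (b.1, !b.2)

/-- `w'` is a cyclic permutation of `w` (at the level of the underlying reduced words). -/
def CyclicPerm {V : Type*} [DecidableEq V] (w w' : FreeGroup V) : Prop :=
  ∃ l₁ l₂ : List (V × Bool), w.toWord = l₁ ++ l₂ ∧ w'.toWord = l₂ ++ l₁

/-- A set of relators is symmetrized if all its elements are cyclically reduced and it is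
closed under inverses and cyclic permutations. -/
def Symmetrized {V : Type*} [DecidableEq V] (R : Set (FreeGroup V)) : Prop :=
  (∀ r ∈ R, CyclicallyReduced r) ∧ (∀ r ∈ R, r⁻¹ ∈ R) ∧
    ∀ r ∈ R, ∀ w, CyclicPerm r w → w ∈ R

/-- A piece relative to `R` is a nonempty word which is an initial segment of two distinct
elements of `R`. -/
def IsPiece {V : Type*} [DecidableEq V] (R : Set (FreeGroup V)) (u : FreeGroup V) : Prop :=
  u ≠ 1 ∧ ∃ r₁ ∈ R, ∃ r₂ ∈ R, r₁ ≠ r₂ ∧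
    u.toWord <+: r₁.toWord ∧ u.toWord <+: r₂.toWord

/-- The small cancellation condition `C'(1/6)`: every piece occurring as an initial
segment of a relator `r` has length `< |r| / 6`. -/
def CondC6 {V : Type*} [DecidableEq V] (R : Set (FreeGroup V)) : Prop :=
  ∀ u, IsPiece R u → ∀ r ∈ R, u.toWord <+: r.toWord →
    (u.toWord.length : ℚ) < (r.toWord.length : ℚ) / 6

/-- The smallest symmetrized subset of the free group containing a given set `B`. -/
def symClosure (B : Set (FreeGroup ℕ)) : Set (FreeGroup ℕ) :=
  ⋂₀ {R | B ⊆ R ∧ Symmetrized R}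

/-- admissible pair/length data -/
def goodLen (T : SimpleGraph ℕ) (i j n : ℕ) : Prop :=
  (i = j ∧ n = 7) ∨ (T.Adj i j ∧ n = 22) ∨ (i ≠ j ∧ ¬ T.Adj i j ∧ n = 26)

/-- explicit form of the words -/
def goodWord (T : SimpleGraph ℕ) (w : List (ℕ × Bool)) : Prop :=
  ∃ i j b, goodLen T i j w.length ∧
    ∀ k (hk : k < w.length), w[k] = (if k % 2 = 0 then i else j, b)

/-- explicit description of the relators -/
def explicitRels (T : SimpleGraph ℕ) : Set (FreeGroup ℕ) := {r | goodWord T r.toWord}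

theorem goodLen_symm {T : SimpleGraph ℕ} {i j n : ℕ} (h : goodLen T i j n) :
    goodLen T j i n := by
  unfold goodLen at *
  rw [T.adj_comm j i]
  rcases h with h | h | h
  · exact Or.inl ⟨h.1.symm, h.2⟩
  · exact Or.inr (Or.inl h)
  · exact Or.inr (Or.inr ⟨h.1.symm, h.2⟩)

theorem goodLen_par {T : SimpleGraph ℕ} {i j n : ℕ} (h : goodLen T i j n) :
    7 ≤ n ∧ (i = j ∨ n % 2 = 0) := by
  unfold goodLen at *
  rcases h with h | h | h
  · exact ⟨by omega, Or.inl h.1⟩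
  · exact ⟨by omega, Or.inr (by omega)⟩
  · exact ⟨by omega, Or.inr (by omega)⟩

theorem goodLen_unique {T : SimpleGraph ℕ} {i j n m : ℕ} (h : goodLen T i j n)
    (h' : goodLen T i j m) : n = m := by
  unfold goodLen at *
  rcases h with ⟨h, rfl⟩ | ⟨h, rfl⟩ | ⟨h, h2, rfl⟩ <;>
    rcases h' with ⟨h', rfl⟩ | ⟨h', rfl⟩ | ⟨h', h2', rfl⟩ <;> first | rfl | skip
  all_goals exfalso
  · subst h; exact T.irrefl h'
  · exact h' h
  · subst h'; exact T.irrefl h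
  · exact h2' h
  · exact h h'
  · exact h2 h'

theorem goodWord_of_shift {T : SimpleGraph ℕ} {w w' : List (ℕ × Bool)} (h : goodWord T w)
    (hl : w'.length = w.length)
    (hs : ∃ s : ℕ, ∃ f : Bool → Bool, ∀ k (hk : k < w'.length), ∃ m, ∃ hm : m < w.length,
      w'[k] = (w[m].1, f w[m].2) ∧ (w.length % 2 = 0 → m % 2 = (k + s) % 2)) :
    goodWord T w' := by
  obtain ⟨i, j, b, hg, hw⟩ := h
  obtain ⟨s, f, hs⟩ := hs
  rcases (goodLen_par hg).2 with hij | hev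
  · subst hij
    refine ⟨i, i, f b, hl ▸ hg, fun k hk => ?_⟩
    obtain ⟨m, hm, h1, -⟩ := hs k hk
    rw [h1, hw m hm]; simp
  · rcases Nat.mod_two_eq_zero_or_one s with h0 | h0
    · refine ⟨i, j, f b, hl ▸ hg, fun k hk => ?_⟩
      obtain ⟨m, hm, h1, h2⟩ := hs k hk
      have : m % 2 = k % 2 := by have := h2 hev; omega
      rw [h1, hw m hm, this]
    · refine ⟨j, i, f b, hl ▸ goodLen_symm hg, fun k hk => ?_⟩
      obtain ⟨m, hm, h1, h2⟩ := hs k hk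
      have : m % 2 = (k + 1) % 2 := by have := h2 hev; omega
      rw [h1, hw m hm, this]
      rcases Nat.mod_two_eq_zero_or_one k with h | h
      · have : (k + 1) % 2 = 1 := by omega
        simp [h, this]
      · have : (k + 1) % 2 = 0 := by omega
        simp [h, this]

theorem explicit_symmetrized (T : SimpleGraph ℕ) : Symmetrized (explicitRels T) := by
  refine ⟨?_, ?_, ?_⟩
  · rintro r ⟨i, j, b, hg, hw⟩ a ha c hc
    have hn := (goodLen_par hg).1
    generalize r.toWord = w at *
    rw [List.head?_eq_getElem?, Option.mem_def, List.getElem?_eq_some_iff] at ha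
    rw [List.getLast?_eq_getElem?, Option.mem_def, List.getElem?_eq_some_iff] at hc
    obtain ⟨h1, rfl⟩ := ha
    obtain ⟨h2, rfl⟩ := hc
    rw [hw _ h1, hw _ h2]
    intro h
    have := congrArg Prod.snd h
    simp at this
  · intro r hr
    have hr' : goodWord T r.toWord := hr
    show goodWord T r⁻¹.toWord
    rw [FreeGroup.toWord_inv]
    refine goodWord_of_shift hr' (by simp) ⟨r.toWord.length + 1, not, fun k hk => ?_⟩
    simp only [FreeGroup.invRev_length] at hk
    refine ⟨r.toWord.length - 1 - k, by omega, ?_, by omega⟩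
    simp [FreeGroup.invRev]
  · rintro r hr w ⟨l₁, l₂, h1, h2⟩
    have hr' : goodWord T r.toWord := hr
    show goodWord T w.toWord
    rw [h1] at hr'
    rw [h2]
    refine goodWord_of_shift hr' (by simp [add_comm]) ⟨l₁.length, id, fun k hk => ?_⟩
    simp only [List.length_append] at hk ⊢
    by_cases hk2 : k < l₂.length
    · refine ⟨k + l₁.length, by omega, ?_, by omega⟩
      rw [List.getElem_append_left hk2, List.getElem_append_right (by omega)]
      simp
    · refine ⟨k - l₂.length, by omega, ?_, by omega⟩
      rw [List.getElem_append_right (by omega), List.getElem_append_left (by omega)]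
      simp

theorem isReduced_pos (l : List ℕ) : FreeGroup.IsReduced (l.map (fun i => (i, true))) := by
  unfold FreeGroup.IsReduced
  rw [List.isChain_map]
  induction l with
  | nil => simp
  | cons a l ih =>
    cases l with
    | nil => simp
    | cons b l => simpa using ih

theorem toWord_pos (l : List ℕ) :
    ((l.map FreeGroup.of).prod).toWord = l.map (fun i => (i, true)) := by
  have h1 : (l.map FreeGroup.of).prod = FreeGroup.mk (l.map (fun i => (i, true))) := by
    induction l with
    | nil => rfl
    | cons a l ih =>
      rw [List.map_cons, List.prod_cons, ih, FreeGroup.of, FreeGroup.mul_mk]; rfl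
  rw [h1, FreeGroup.toWord_mk]
  exact (isReduced_pos l).reduce_eq

theorem goodWord_pos {T : SimpleGraph ℕ} (i j : ℕ) (l : List ℕ) (hg : goodLen T i j l.length)
    (hl : ∀ k (hk : k < l.length), l[k] = if k % 2 = 0 then i else j) :
    (l.map FreeGroup.of).prod ∈ explicitRels T := by
  show goodWord T _
  rw [toWord_pos]
  refine ⟨i, j, true, by simpa using hg, fun k hk => ?_⟩
  simp only [List.length_map] at hk
  simp [hl k hk]

theorem base_subset (T : SimpleGraph ℕ) : grRels T.Adj ⊆ explicitRels T := by
  have key : ∀ i j n, goodLen T i j n → 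
      ((List.range n).map (fun k => FreeGroup.of (if k % 2 = 0 then i else j))).prod
        ∈ explicitRels T := by
    intro i j n h
    have := goodWord_pos (T := T) i j ((List.range n).map (fun k => if k % 2 = 0 then i else j))
      (by simpa using h) (by simp)
    simpa [List.map_map, Function.comp_def] using this
  rintro r (⟨i, rfl⟩ | ⟨i, j, h, rfl⟩ | ⟨i, j, h, h2, rfl⟩)
  · convert key i i 7 (Or.inl ⟨rfl, rfl⟩) using 1
    simp [List.range_succ, pow_succ, mul_assoc]
  · convert key i j 22 (Or.inr (Or.inl ⟨h, rfl⟩)) using 1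
    simp [List.range_succ, pow_succ, mul_assoc]
  · convert key i j 26 (Or.inr (Or.inr ⟨h, h2, rfl⟩)) using 1
    simp [List.range_succ, pow_succ, mul_assoc]

theorem explicit_C6 (T : SimpleGraph ℕ) : CondC6 (explicitRels T) := by
  rintro u ⟨-, r₁, h₁, r₂, h₂, hne, hp₁, hp₂⟩ r ⟨i, j, b, hg, -⟩ -
  have hn := (goodLen_par hg).1
  have hu : u.toWord.length ≤ 1 := by
    by_contra hlt
    apply hne
    apply FreeGroup.toWord_injective
    obtain ⟨i₁, j₁, b₁, hg₁, hw₁⟩ := h₁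
    obtain ⟨i₂, j₂, b₂, hg₂, hw₂⟩ := h₂
    have hl₁ := hp₁.length_le
    have hl₂ := hp₂.length_le
    have e0 : r₁.toWord[0] = r₂.toWord[0] := by
      rw [← hp₁.getElem (by omega), ← hp₂.getElem (by omega)]
    have e1 : r₁.toWord[1] = r₂.toWord[1] := by
      rw [← hp₁.getElem (by omega), ← hp₂.getElem (by omega)]
    rw [hw₁, hw₂] at e0 e1
    simp at e0 e1
    obtain ⟨rfl, rfl⟩ := e0
    obtain ⟨rfl, -⟩ := e1
    apply List.ext_getElem (goodLen_unique hg₁ hg₂)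
    intro k hk hk'
    rw [hw₁, hw₂]
  have h1 : (u.toWord.length : ℚ) ≤ 1 := by exact_mod_cast hu
  have h2 : (7 : ℚ) ≤ r.toWord.length := by exact_mod_cast hn
  linarith

theorem RT_symmetrized_sixth (T : SimpleGraph ℕ) :
    Symmetrized (symClosure (grRels T.Adj)) ∧ CondC6 (symClosure (grRels T.Adj)) := by
  have hsub : symClosure (grRels T.Adj) ⊆ explicitRels T :=
    Set.sInter_subset_of_mem ⟨base_subset T, explicit_symmetrized T⟩
  refine ⟨⟨?_, ?_, ?_⟩, ?_⟩
  · exact fun r hr => (explicit_symmetrized T).1 r (hsub hr)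
  · exact fun r hr R hR => hR.2.2.1 r (hr R hR)
  · exact fun r hr w hw R hR => hR.2.2.2 r (hr R hR) w hw
  · rintro u ⟨hu, r₁, h₁, r₂, h₂, h⟩ r hr
    exact explicit_C6 T u ⟨hu, r₁, hsub h₁, r₂, hsub h₂, h⟩ r (hsub hr)
end

section
/- Let T be a simple graph on vertex set ℕ. In the group G_T: every generator v_i has order exactly 7; for all distinct i, j ∈ ℕ, the element v_i v_j has order exactly 11 if i and j are adjacent in T, and order exactly 13 if i and j are not adjacent in T. -/
/-- The coefficient ring: 2 x 2 matrices over the field with 307 elements. -/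
abbrev RR : Type := Matrix (Fin 2) (Fin 2) (ZMod 307)

/-- A matrix of order 7 without eigenvalue 1. -/
def mA : RR := !![0, 306; 1, 63]

def mY : Bool → RR
  | true => !![9, 9; 236, 135]
  | false => !![24, 13; 17, 145]

/-- The action of a product of two generators on the two relevant coordinates. -/
def mM (b : Bool) : Matrix (Fin 2) (Fin 2) RR := !![mA, mA; mY b, mA + mY b]

theorem sumA : ∑ k ∈ Finset.range 7, mA ^ k = 0 := by
  have h1 : ∑ k ∈ Finset.range 1, mA ^ k = 1 := by simp
  have h2 : ∑ k ∈ Finset.range 2, mA ^ k = !![1, 306; 1, 64] := by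
    rw [geom_sum_succ, h1]; decide +kernel
  have h3 : ∑ k ∈ Finset.range 3, mA ^ k = !![0, 243; 64, 41] := by
    rw [geom_sum_succ, h2]; decide +kernel
  have h4 : ∑ k ∈ Finset.range 4, mA ^ k = !![244, 266; 41, 64] := by
    rw [geom_sum_succ, h3]; decide +kernel
  have h5 : ∑ k ∈ Finset.range 5, mA ^ k = !![267, 243; 64, 1] := by
    rw [geom_sum_succ, h4]; decide +kernel
  have h6 : ∑ k ∈ Finset.range 6, mA ^ k = !![244, 306; 1, 0] := by
    rw [geom_sum_succ, h5]; decide +kernel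
  have h7 : ∑ k ∈ Finset.range 7, mA ^ k = 0 := by
    rw [geom_sum_succ, h6]; decide +kernel
  exact h7

theorem sumM_true : ∑ k ∈ Finset.range 11, mM true ^ k = 0 := by
  have h1 : ∑ k ∈ Finset.range 1, mM true ^ k = 1 := by simp
  have h2 : ∑ k ∈ Finset.range 2, mM true ^ k = !![!![1, 306; 1, 64], !![0, 306; 1, 63]; !![9, 9; 236, 135], !![10, 8; 237, 199]] := by
    rw [geom_sum_succ, h1]; decide +kernel
  have h3 : ∑ k ∈ Finset.range 3, mM true ^ k = !![!![71, 108; 205, 266], !![69, 45; 268, 242]; !![145, 193; 112, 120], !![154, 73; 4, 141]] := by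
    rw [geom_sum_succ, h2]; decide +kernel
  have h4 : ∑ k ∈ Finset.range 4, mM true ^ k = !![!![298, 228; 232, 60], !![35, 231; 167, 301]; !![80, 230; 276, 117], !![154, 70; 110, 94]] := by
    rw [geom_sum_succ, h3]; decide +kernel
  have h5 : ∑ k ∈ Finset.range 5, mM true ^ k = !![!![107, 130; 147, 251], !![30, 219; 141, 12]; !![23, 72; 266, 206], !![94, 30; 53, 186]] := by
    rw [geom_sum_succ, h4]; decide +kernel
  have h6 : ∑ k ∈ Finset.range 6, mM true ^ k = !![!![202, 157; 54, 136], !![113, 109; 66, 136]; !![16, 199; 64, 231], !![47, 153; 250, 231]] := by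
    rw [geom_sum_succ, h5]; decide +kernel
  have h7 : ∑ k ∈ Finset.range 7, mM true ^ k = !![!![190, 247; 284, 146], !![298, 247; 113, 51]; !![197, 136; 202, 32], !![44, 211; 126, 214]] := by
    rw [geom_sum_succ, h6]; decide +kernel
  have h8 : ∑ k ∈ Finset.range 8, mM true ^ k = !![!![129, 129; 305, 239], !![68, 42; 49, 268]; !![287, 105; 94, 217], !![192, 153; 1, 66]] := by
    rw [geom_sum_succ, h7]; decide +kernel
  have h9 : ∑ k ∈ Finset.range 9, mM true ^ k = !![!![216, 158; 72, 105], !![257, 280; 33, 54]; !![180, 160; 145, 85], !![27, 90; 211, 252]] := by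
    rw [geom_sum_succ, h8]; decide +kernel
  have h10 : ∑ k ∈ Finset.range 10, mM true ^ k = !![!![91, 117; 252, 9], !![63, 1; 306, 0]; !![153, 189; 56, 298], !![244, 306; 1, 0]] := by
    rw [geom_sum_succ, h9]; decide +kernel
  have h11 : ∑ k ∈ Finset.range 11, mM true ^ k = 0 := by
    rw [geom_sum_succ, h10]; decide +kernel
  exact h11

theorem sumM_false : ∑ k ∈ Finset.range 13, mM false ^ k = 0 := by
  have h1 : ∑ k ∈ Finset.range 1, mM false ^ k = 1 := by simp
  have h2 : ∑ k ∈ Finset.range 2, mM false ^ k = !![!![1, 306; 1, 64], !![0, 306; 1, 63]; !![24, 13; 17, 145], !![25, 12; 18, 209]] := by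
    rw [geom_sum_succ, h1]; decide +kernel
  have h3 : ∑ k ∈ Finset.range 3, mM false ^ k = !![!![290, 98; 238, 286], !![288, 35; 301, 262]; !![203, 97; 139, 54], !![216, 214; 41, 3]] := by
    rw [geom_sum_succ, h2]; decide +kernel
  have h4 : ∑ k ∈ Finset.range 4, mM false ^ k = !![!![238, 274; 298, 126], !![272, 42; 253, 59]; !![16, 143; 168, 240], !![231, 208; 171, 82]] := by
    rw [geom_sum_succ, h3]; decide +kernel
  have h5 : ∑ k ∈ Finset.range 5, mM false ^ k = !![!![149, 248; 140, 144], !![190, 166; 199, 230]; !![13, 97; 212, 207], !![222, 76; 294, 291]] := by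
    rw [geom_sum_succ, h4]; decide +kernel
  have h6 : ∑ k ∈ Finset.range 6, mM false ^ k = !![!![263, 263; 234, 48], !![121, 93; 157, 216]; !![270, 49; 237, 209], !![40, 10; 221, 136]] := by
    rw [geom_sum_succ, h5]; decide +kernel
  have h7 : ∑ k ∈ Finset.range 7, mM false ^ k = !![!![144, 50; 120, 233], !![236, 262; 29, 175]; !![258, 182; 150, 218], !![269, 158; 286, 277]] := by
    rw [geom_sum_succ, h6]; decide +kernel
  have h8 : ∑ k ∈ Finset.range 8, mM false ^ k = !![!![38, 163; 220, 95], !![299, 162; 88, 38]; !![114, 161; 125, 58], !![273, 22; 95, 32]] := by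
    rw [geom_sum_succ, h7]; decide +kernel
  have h9 : ∑ k ∈ Finset.range 9, mM false ^ k = !![!![270, 154; 90, 140], !![124, 237; 128, 296]; !![26, 190; 119, 194], !![49, 75; 151, 274]] := by
    rw [geom_sum_succ, h8]; decide +kernel
  have h10 : ∑ k ∈ Finset.range 10, mM false ^ k = !![!![99, 280; 262, 204], !![28, 44; 251, 303]; !![185, 124; 187, 71], !![261, 195; 154, 298]] := by
    rw [geom_sum_succ, h9]; decide +kernel
  have h11 : ∑ k ∈ Finset.range 11, mM false ^ k = !![!![166, 32; 20, 231], !![209, 13; 16, 34]; !![186, 306; 237, 71], !![75, 50; 228, 272]] := by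
    rw [geom_sum_succ, h10]; decide +kernel
  have h12 : ∑ k ∈ Finset.range 12, mM false ^ k = !![!![51, 5; 272, 24], !![63, 1; 306, 0]; !![193, 301; 36, 283], !![244, 306; 1, 0]] := by
    rw [geom_sum_succ, h11]; decide +kernel
  have h13 : ∑ k ∈ Finset.range 13, mM false ^ k = 0 := by
    rw [geom_sum_succ, h12]; decide +kernel
  exact h13

theorem mA_ne_one : mA ≠ 1 := by decide +kernel

/-- Iterates of a map of the shape `f ↦ f + Q (P f)`. -/
theorem iter_formula {V W : Type*} [AddCommGroup V] [AddCommGroup W]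
    (t : Function.End V) (P : V → W) (Q : W →+ V) (m : ℕ → W → W)
    (h0 : ∀ w, m 0 w = 0) (hs : ∀ n w, ∃ w', (∀ f, P f = w → P (t f) = w') ∧
      m (n + 1) w = w + m n w')
    (ht : ∀ f, t f = f + Q (P f)) (n : ℕ) :
    ∀ f, (t ^ n) f = f + Q (m n (P f)) := by
  induction n with
  | zero => intro f; rw [h0, map_zero, add_zero]; rfl
  | succ n ih =>
    intro f
    obtain ⟨w', h1, h2⟩ := hs n (P f)
    have : (t ^ (n + 1)) f = (t ^ n) (t f) := by rw [pow_succ]; rfl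
    rw [this, ih, h1 f rfl, h2, map_add, ht f, add_assoc]

open Classical in
/-- Off-diagonal and diagonal structure coefficients. -/
noncomputable def coef (T : SimpleGraph ℕ) (k i : ℕ) : RR :=
  if k = i then mA - 1 else if k < i then 1 else mY (decide (T.Adj k i))

/-- The generator action on sequences. -/
noncomputable def act (T : SimpleGraph ℕ) (i : ℕ) : Function.End (ℕ → RR) :=
  fun f k => f k + coef T k i * f i

theorem act_pow (T : SimpleGraph ℕ) (i : ℕ) : act T i ^ 7 = 1 := by
  have key := iter_formula (act T i) (fun f => f i)
    (AddMonoidHom.mk' (fun w k => coef T k i * w) (by intro a b; ext1 k; simp [mul_add]))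
    (fun n w => (∑ k ∈ Finset.range n, mA ^ k) * w) (by simp)
    (by
      intro n w
      refine ⟨mA * w, ?_, ?_⟩
      · rintro f rfl
        simp [act, coef, sub_mul]
      · simp only [Finset.sum_range_succ', pow_succ, ← Finset.sum_mul]
        simp [add_mul, mul_assoc, add_comm])
    (by intro f; rfl) 7
  funext f
  rw [key f, sumA]
  simp only [zero_mul, map_zero, add_zero]
  rfl

theorem act_mul_pow (T : SimpleGraph ℕ) (i j : ℕ) (hij : i < j) (b : Bool) (n : ℕ)
    (hb : coef T j i = mY b) (hn : ∑ k ∈ Finset.range n, mM b ^ k = 0) :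
    (act T i * act T j) ^ n = 1 := by
  have hX : coef T i j = 1 := by simp [coef, hij.ne, hij]
  have hi : coef T i i = mA - 1 := by simp [coef]
  have hj : coef T j j = mA - 1 := by simp [coef]
  have key := iter_formula (act T i * act T j) (fun f => (![f i, f j] : Fin 2 → RR))
    (AddMonoidHom.mk' (fun w k => coef T k i * (w 0 + w 1) + coef T k j * w 1)
      (by intro a b; ext1 k; simp only [Pi.add_apply, mul_add]; abel))
    (fun n w => (∑ k ∈ Finset.range n, mM b ^ k).mulVec w) (by simp)
    (by
      intro n w
      refine ⟨(mM b).mulVec w, ?_, ?_⟩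
      · rintro f rfl
        change (![act T i (act T j f) i, act T i (act T j f) j] : Fin 2 → RR) = _
        funext x
        fin_cases x
        · simp [act, mM, hX, hi, hj, hb, Matrix.mulVec, dotProduct, Fin.sum_univ_two]
          noncomm_ring
        · simp [act, mM, hX, hi, hj, hb, Matrix.mulVec, dotProduct, Fin.sum_univ_two]
          noncomm_ring
      · simp only [Finset.sum_range_succ', pow_succ, ← Finset.sum_mul]
        rw [Matrix.add_mulVec, ← Matrix.mulVec_mulVec, pow_zero, Matrix.one_mulVec, add_comm])
    (by
      intro f
      change act T i (act T j f) = _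
      funext k
      simp only [act, hX, Pi.add_apply, AddMonoidHom.mk'_apply, Matrix.cons_val_zero,
        Matrix.cons_val_one, one_mul]
      abel) n
  funext f
  rw [key f, hn]
  simp only [Matrix.zero_mulVec, map_zero, add_zero]
  rfl

/-- The generator action as a unit. -/
noncomputable def uact (T : SimpleGraph ℕ) (i : ℕ) : (Function.End (ℕ → RR))ˣ :=
  Units.ofPowEqOne (act T i) 7 (act_pow T i) (by norm_num)

theorem uact_val (T : SimpleGraph ℕ) (i : ℕ) :
    ((uact T i : (Function.End (ℕ → RR))ˣ) : Function.End (ℕ → RR)) = act T i := rfl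

theorem pow_swap {G : Type*} [Group G] (a b : G) (n : ℕ) (h : (a * b) ^ n = 1) :
    (b * a) ^ n = 1 := by
  have : b * a = b * (a * b) * b⁻¹ := by group
  rw [this, conj_pow, h]; group

theorem uact_mul_pow_lt (T : SimpleGraph ℕ) (i j : ℕ) (hij : i < j) :
    (T.Adj i j → (uact T i * uact T j) ^ 11 = 1) ∧
    (¬ T.Adj i j → (uact T i * uact T j) ^ 13 = 1) := by
  constructor
  · intro h
    ext1
    exact act_mul_pow T i j hij true 11
      (by simp [coef, hij.ne', hij.le, h.symm]) sumM_true
  · intro h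
    ext1
    exact act_mul_pow T i j hij false 13
      (by simp [coef, hij.ne', hij.le, T.adj_comm j i, h]) sumM_false

theorem uact_mul_pow (T : SimpleGraph ℕ) (i j : ℕ) (hij : i ≠ j) :
    (T.Adj i j → (uact T i * uact T j) ^ 11 = 1) ∧
    (¬ T.Adj i j → (uact T i * uact T j) ^ 13 = 1) := by
  rcases lt_or_gt_of_ne hij with h | h
  · exact uact_mul_pow_lt T i j h
  · have := uact_mul_pow_lt T j i h
    rw [T.adj_comm j i] at this
    exact ⟨fun k => pow_swap _ _ _ (this.1 k), fun k => pow_swap _ _ _ (this.2 k)⟩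

theorem uact_rels (T : SimpleGraph ℕ) :
    ∀ r ∈ grRels T.Adj, FreeGroup.lift (uact T) r = 1 := by
  rintro r (⟨i, rfl⟩ | ⟨i, j, h, rfl⟩ | ⟨i, j, hne, h, rfl⟩)
  · rw [map_pow, FreeGroup.lift_apply_of]
    ext1
    exact act_pow T i
  · rw [map_pow, map_mul, FreeGroup.lift_apply_of, FreeGroup.lift_apply_of]
    exact (uact_mul_pow T i j h.ne).1 h
  · rw [map_pow, map_mul, FreeGroup.lift_apply_of, FreeGroup.lift_apply_of]
    exact (uact_mul_pow T i j hne).2 h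

/-- The representation of `G_T`. -/
noncomputable def rep (T : SimpleGraph ℕ) : GT T.Adj →* (Function.End (ℕ → RR))ˣ :=
  PresentedGroup.toGroup (uact_rels T)

theorem rep_gen (T : SimpleGraph ℕ) (i : ℕ) : rep T (gen T.Adj i) = uact T i :=
  PresentedGroup.toGroup.of (uact_rels T)

theorem gen_ne_one (T : SimpleGraph ℕ) (i : ℕ) : gen T.Adj i ≠ 1 := by
  intro h
  have h1 := congrArg (rep T) h
  rw [rep_gen, map_one] at h1
  have h2 : act T i = 1 := congrArg Units.val h1
  have h3 : act T i (Pi.single i 1) i = (Pi.single i 1 : ℕ → RR) i := by rw [h2]; rfl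
  simp [act, coef] at h3
  exact mA_ne_one h3

theorem gen_mul_ne_one (T : SimpleGraph ℕ) (i j : ℕ) (hij : i ≠ j) :
    gen T.Adj i * gen T.Adj j ≠ 1 := by
  intro h
  have h1 := congrArg (rep T) h
  rw [map_mul, rep_gen, rep_gen, map_one] at h1
  have h2 : act T i * act T j = 1 := congrArg Units.val h1
  have h3 : act T i (act T j (Pi.single i 1)) i = (Pi.single i 1 : ℕ → RR) i :=
    congrFun (congrFun h2 (Pi.single i 1)) i
  simp [act, coef, hij, hij.symm] at h3
  exact mA_ne_one h3

theorem gen_rel (T : SimpleGraph ℕ) (r : FreeGroup ℕ) (h : r ∈ grRels T.Adj) :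
    PresentedGroup.mk (grRels T.Adj) r = 1 :=
  PresentedGroup.one_of_mem h

/-- In `G_T`, every generator `v_i` has order exactly `7`; for distinct `i, j`, the element
`v_i v_j` has order exactly `11` if `i, j` are adjacent in `T`, and order exactly `13`
otherwise. -/
theorem orders_in_GT (T : SimpleGraph ℕ) :
    (∀ i, orderOf (gen T.Adj i) = 7) ∧
      ∀ i j, i ≠ j →
        (T.Adj i j → orderOf (gen T.Adj i * gen T.Adj j) = 11) ∧
        (¬ T.Adj i j → orderOf (gen T.Adj i * gen T.Adj j) = 13) := by
  refine ⟨fun i => ?_, fun i j hij => ⟨fun h => ?_, fun h => ?_⟩⟩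
  · have : Fact (Nat.Prime 7) := ⟨by norm_num⟩
    exact orderOf_eq_prime (gen_rel T _ (Or.inl ⟨i, rfl⟩)) (gen_ne_one T i)
  · have : Fact (Nat.Prime 11) := ⟨by norm_num⟩
    exact orderOf_eq_prime (gen_rel T _ (Or.inr (Or.inl ⟨i, j, h, rfl⟩)))
      (gen_mul_ne_one T i j hij)
  · have : Fact (Nat.Prime 13) := ⟨by norm_num⟩
    exact orderOf_eq_prime (gen_rel T _ (Or.inr (Or.inr ⟨i, j, hij, h, rfl⟩)))
      (gen_mul_ne_one T i j hij)
end
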